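/- arXiv:1608.06013 — 2 statements merged into one kernel-verified Lean document; each statement's English description precedes it below -/
import Mathlib

section
/- Let M be an internally 4-connected binary matroid in which every element is in exactly three triangles and whose ground set has at least 14 elements. Suppose {e, f_1, f_2, f_3} is a 4-element cocircuit of M and g_1, g_2, g_3 are elements such that {e, f_i, g_i} is a triangle of M for each i in {1, 2, 3}. Then the matroid M/e \ {f_1, f_2, f_3} (the contraction of e followed by the deletion of f_1, f_2, f_3) has no triads. -/
open Set Matroid

namespace Paper

variable {α : Type*}

/-- A circuit of a matroid: a minimal dependent set. -/
def Circuit (M : Matroid α) (C : Set α) : Prop :=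
  C ⊆ M.E ∧ ¬ M.Indep C ∧ ∀ D, D ⊂ C → M.Indep D

/-- A cocircuit: a circuit of the dual matroid. -/
def Cocircuit (M : Matroid α) (C : Set α) : Prop := Circuit M✶ C

/-- A triangle: a 3-element circuit. -/
def IsTriangle (M : Matroid α) (T : Set α) : Prop := Circuit M T ∧ T.encard = 3

/-- A triad: a 3-element cocircuit. -/
def IsTriad (M : Matroid α) (T : Set α) : Prop := Cocircuit M T ∧ T.encard = 3

/-- The (extended) rank of a set: the supremum of the cardinalities of
independent subsets. -/
noncomputable def eRank (M : Matroid α) (X : Set α) : ℕ∞ :=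
  ⨆ I ∈ {I : Set α | M.Indep I ∧ I ⊆ X}, I.encard

/-- The rank of the matroid. -/
noncomputable def eRk (M : Matroid α) : ℕ∞ := eRank M M.E

/-- `(X, Y)` is a `k`-separation of `M`: a partition of the ground set into
two sets, each of size at least `k`, with `λ(X) = r(X) + r(Y) - r(M) ≤ k - 1`. -/
def IsKSeparation (M : Matroid α) (k : ℕ) (X Y : Set α) : Prop :=
  Disjoint X Y ∧ X ∪ Y = M.E ∧
    eRank M X + eRank M Y ≤ eRk M + ((k - 1 : ℕ) : ℕ∞) ∧
    (k : ℕ∞) ≤ X.encard ∧ (k : ℕ∞) ≤ Y.encard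

/-- `M` is `n`-connected if it has no `k`-separation for any positive `k < n`. -/
def NConnected (M : Matroid α) (n : ℕ) : Prop :=
  ∀ k, 1 ≤ k → k < n → ∀ X Y, ¬ IsKSeparation M k X Y

/-- `M` is internally 4-connected if it is 3-connected and every
3-separation has a side that is a triangle or a triad. -/
def InternallyFourConnected (M : Matroid α) : Prop :=
  NConnected M 3 ∧ ∀ X Y, IsKSeparation M 3 X Y →
    IsTriangle M X ∨ IsTriad M X ∨ IsTriangle M Y ∨ IsTriad M Y

/-- `M` is binary: representable over `GF(2)`. -/
def Binary (M : Matroid α) : Prop :=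
  ∃ φ : α → (α →₀ ZMod 2), ∀ I, I ⊆ M.E →
    (M.Indep I ↔ LinearIndependent (ZMod 2) (fun x : I => φ x.1))

/-- Every element of `M` is in exactly three triangles. -/
def EveryElementInThreeTriangles (M : Matroid α) : Prop :=
  ∀ e ∈ M.E, {T : Set α | IsTriangle M T ∧ e ∈ T}.encard = 3

/-- Deletion of a set of elements. -/
def delete (M : Matroid α) (D : Set α) : Matroid α := M ↾ (M.E \ D)

/-- Contraction of a set of elements. -/
def contract (M : Matroid α) (C : Set α) : Matroid α := (delete M✶ C)✶

/-- A nonloop. -/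
def Nonloop (M : Matroid α) (e : α) : Prop := M.Indep {e}

/-- `N` is a simplification of `M`: the restriction of `M` to a set of
nonloops containing exactly one element from each parallel class. -/
def IsSimplificationOf (N M : Matroid α) : Prop :=
  ∃ S, S ⊆ M.E ∧ N = M ↾ S ∧ (∀ e ∈ S, Nonloop M e) ∧
    ∀ f, Nonloop M f → ∃! e, e ∈ S ∧ M.closure {e} = M.closure {f}

/-- `si(M/e)` is internally 4-connected. -/
def SiContractI4C (M : Matroid α) (e : α) : Prop :=
  ∀ N, IsSimplificationOf N (contract M {e}) → InternallyFourConnected N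

/-- A set is fully closed if it is closed in `M` and in `M✶`. -/
def FullyClosed (M : Matroid α) (F : Set α) : Prop :=
  M.closure F = F ∧ M✶.closure F = F

/-- The full closure of a set: the intersection of all fully closed sets
containing it. -/
def fcl (M : Matroid α) (Z : Set α) : Set α := ⋂₀ {F | Z ⊆ F ∧ FullyClosed M F}

/-- An exact 4-separation: a 4-separation with `λ = 3`. -/
def IsExact4Separation (M : Matroid α) (X Y : Set α) : Prop :=
  Disjoint X Y ∧ X ∪ Y = M.E ∧
    eRank M X + eRank M Y = eRk M + 3 ∧
    (4 : ℕ∞) ≤ X.encard ∧ (4 : ℕ∞) ≤ Y.encard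





lemma eRank_eq {α : Type*} (M : Matroid α) (X : Set α) : eRank M X = M.eRk X := by
  unfold eRank
  apply le_antisymm
  · refine iSup₂_le fun I hI => ?_
    exact hI.1.encard_le_eRk_of_subset hI.2
  · obtain ⟨I, hIX, hI, hc⟩ := Matroid.le_eRk_iff.1 (le_refl (M.eRk X))
    rw [← hc]
    exact le_iSup₂_of_le I ⟨hI, hIX⟩ le_rfl

/-- `v` represents `M` over GF(2). -/
def Rep {α : Type*} (M : Matroid α) (v : α → (α →₀ ZMod 2)) : Prop :=
  ∀ I, I ⊆ M.E → (M.Indep I ↔ LinearIndependent (ZMod 2) (fun x : I => v x.1))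

lemma Rep.mem_closure {α : Type*} {M : Matroid α} {v : α → (α →₀ ZMod 2)} (hv : Rep M v)
    {S : Set α} (hS : S ⊆ M.E) {x : α} (hx : x ∈ M.E) :
    x ∈ M.closure S ↔ v x ∈ Submodule.span (ZMod 2) (v '' S) := by
  have key : ∀ I, M.Indep I → ∀ x ∈ M.E,
      (x ∈ M.closure I ↔ v x ∈ Submodule.span (ZMod 2) (v '' I)) := by
    intro I hI x hx
    by_cases hxI : x ∈ I
    · exact iff_of_true (M.mem_closure_of_mem hxI hI.subset_ground)
        (Submodule.subset_span (mem_image_of_mem v hxI))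
    · have hlI : LinearIndepOn (ZMod 2) v I := (hv I hI.subset_ground).1 hI
      have hsub : insert x I ⊆ M.E := insert_subset hx hI.subset_ground
      have h1 : M.Indep (insert x I) ↔ LinearIndepOn (ZMod 2) v (insert x I) := hv _ hsub
      rw [linearIndepOn_insert hxI] at h1
      rw [hI.mem_closure_iff_of_notMem hxI, Matroid.dep_iff, h1]
      tauto
  obtain ⟨I, hI⟩ := M.exists_isBasis S
  rw [← hI.closure_eq_closure, key I hI.indep x hx]
  have : Submodule.span (ZMod 2) (v '' S) = Submodule.span (ZMod 2) (v '' I) := by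
    apply le_antisymm
    · rw [Submodule.span_le]
      rintro _ ⟨y, hy, rfl⟩
      exact (key I hI.indep y (hS hy)).1 (hI.subset_closure hy)
    · exact Submodule.span_mono (image_mono hI.subset)
  rw [this]

lemma z2 : ∀ a : ZMod 2, a ≠ 0 → a = 1 := by decide

lemma Rep.notMem_closure {α : Type*} {M : Matroid α} {v : α → (α →₀ ZMod 2)} (hv : Rep M v)
    {S : Set α} (hS : S ⊆ M.E) {x : α} (hx : x ∈ M.E) (ψ : (α →₀ ZMod 2) →ₗ[ZMod 2] ZMod 2)
    (h0 : ∀ y ∈ S, ψ (v y) = 0) (h1 : ψ (v x) ≠ 0) : x ∉ M.closure S := by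
  rw [hv.mem_closure hS hx]
  intro h
  apply h1
  have : Submodule.span (ZMod 2) (v '' S) ≤ LinearMap.ker ψ := by
    rw [Submodule.span_le]
    rintro _ ⟨y, hy, rfl⟩
    exact h0 y hy
  exact this h

/-- key functional lemma -/
lemma Rep.functional {α : Type*} {M : Matroid α} {v : α → (α →₀ ZMod 2)} (hv : Rep M v)
    {T F : Set α}
    (hx : ∃ x ∈ M.E \ F, x ∉ M.closure ((M.E \ F) \ T))
    (hc : ∀ t ∈ T, M.E \ F ⊆ M.closure ((M.E \ F) \ (T \ {t}))) :
    ∃ ψ : (α →₀ ZMod 2) →ₗ[ZMod 2] ZMod 2,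
      (∀ x ∈ M.E, x ∉ T → x ∉ F → ψ (v x) = 0) ∧ ∀ t ∈ T, ψ (v t) = 1 := by
  obtain ⟨x, hx, hxc⟩ := hx
  have hs : (M.E \ F) \ T ⊆ M.E := sdiff_subset.trans sdiff_subset
  rw [hv.mem_closure hs hx.1] at hxc
  obtain ⟨ψ, h1, h2⟩ := Submodule.exists_le_ker_of_notMem hxc
  have h0 : ∀ x ∈ M.E, x ∉ T → x ∉ F → ψ (v x) = 0 := fun y hy hyT hyF =>
    h2 (Submodule.subset_span (mem_image_of_mem v ⟨⟨hy, hyF⟩, hyT⟩))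
  refine ⟨ψ, h0, fun t ht => z2 _ fun h => ?_⟩
  refine hv.notMem_closure (S := (M.E \ F) \ (T \ {t})) (sdiff_subset.trans sdiff_subset) hx.1 ψ
    ?_ h1 (hc t ht hx)
  rintro y ⟨⟨hyE, hyF⟩, hyT⟩
  by_cases hyt : y = t
  · rw [hyt]; exact h
  · exact h0 y hyE (fun hh => hyT ⟨hh, hyt⟩) hyF

lemma circuit_spanning {α : Type*} {M : Matroid α} {C : Set α} (h : Cocircuit M C) :
    C ⊆ M.E ∧ (∃ x ∈ M.E, x ∉ M.closure (M.E \ C)) ∧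
      ∀ t ∈ C, M.E ⊆ M.closure (M.E \ (C \ {t})) := by
  obtain ⟨hCE, hni, hD⟩ := h
  have hCE : C ⊆ M.E := hCE
  refine ⟨hCE, ?_, fun t ht => ?_⟩
  · have : ¬ M.Spanning (M.E \ C) := by
      rw [← Matroid.coindep_iff_compl_spanning]; exact hni
    rw [Matroid.spanning_iff_ground_subset_closure] at this
    simpa [Set.subset_def] using this
  · have hi : M.Coindep (C \ {t}) := hD _ (by simpa using ht)
    exact (hi.compl_spanning).closure_eq.symm.subset

lemma cocircuit_functional {α : Type*} {M : Matroid α} {v : α → (α →₀ ZMod 2)} (hv : Rep M v)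
    {C : Set α} (h : Cocircuit M C) :
    ∃ ψ : (α →₀ ZMod 2) →ₗ[ZMod 2] ZMod 2,
      (∀ x ∈ M.E, x ∉ C → ψ (v x) = 0) ∧ ∀ t ∈ C, ψ (v t) = 1 := by
  obtain ⟨h1, h2, h3⟩ := circuit_spanning h
  obtain ⟨ψ, h⟩ := hv.functional (T := C) (F := ∅) (by simpa using h2) (by simpa using h3)
  exact ⟨ψ, by simpa using h⟩

lemma minor_functional {α : Type*} {M : Matroid α} {v : α → (α →₀ ZMod 2)} (hv : Rep M v)
    {T F : Set α} {e : α} (he : e ∈ M.E) (heF : e ∉ F)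
    (h : Cocircuit (delete (contract M {e}) F) T) :
    T ⊆ M.E ∧ e ∉ T ∧ Disjoint T F ∧ ∃ ψ : (α →₀ ZMod 2) →ₗ[ZMod 2] ZMod 2,
      (∀ x ∈ M.E, x ∉ T → x ∉ F → ψ (v x) = 0) ∧ ∀ t ∈ T, ψ (v t) = 1 := by
  have hN : delete (contract M {e}) F = (M ／ {e}) ＼ F := rfl
  rw [hN] at h
  obtain ⟨h1, h2, h3⟩ := circuit_spanning h
  simp only [Matroid.delete_ground, Matroid.contract_ground, Matroid.delete_closure_eq,
    Matroid.contract_closure_eq] at h1 h2 h3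
  have hTE : T ⊆ M.E := fun x hx => (h1 hx).1.1
  have heT : e ∉ T := fun hx => (h1 hx).1.2 rfl
  have hTF : Disjoint T F := Set.disjoint_left.2 fun x hx => (h1 hx).2
  have hset : ∀ D ⊆ T, (((M.E \ {e}) \ F) \ D) \ F ∪ {e} = (M.E \ F) \ D := by
    intro D hD
    ext x
    by_cases hxe : x = e
    · subst hxe; have hxD : x ∉ D := fun h => heT (hD h)
      simp [he, heF, hxD]
    · simp [hxe]; tauto
  refine ⟨hTE, heT, hTF, hv.functional ?_ ?_⟩
  · obtain ⟨x, hx, hxc⟩ := h2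
    rw [hset T le_rfl] at hxc
    exact ⟨x, ⟨hx.1.1, hx.2⟩, fun hh => hxc ⟨⟨hh, hx.1.2⟩, hx.2⟩⟩
  · intro t ht x hx
    have := h3 t ht
    rw [hset _ sdiff_subset] at this
    by_cases hxe : x = e
    · subst hxe
      exact M.mem_closure_of_mem ⟨hx, fun h => heT h.1⟩ (sdiff_subset.trans sdiff_subset)
    · exact (this ⟨⟨hx.1, hxe⟩, hx.2⟩).1.1

lemma i4_false {α : Type*} {M : Matroid α} (hI4 : InternallyFourConnected M) {X : Set α}
    (hX : X ⊆ M.E) (k : ℕ∞) (h4 : 4 ≤ X.encard) (h4' : 4 ≤ (M.E \ X).encard)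
    (hr : M.eRk X ≤ k + 2) (hr2 : M.eRk (M.E \ X) + k ≤ M.eRk M.E) : False := by
  have h34 : (3 : ℕ∞) ≤ 4 := by norm_num
  have hsep : IsKSeparation M 3 X (M.E \ X) := by
    refine ⟨disjoint_sdiff_right, union_sdiff_cancel hX, ?_, h34.trans h4, h34.trans h4'⟩
    unfold eRk
    simp only [eRank_eq]
    calc M.eRk X + M.eRk (M.E \ X) ≤ (k + 2) + M.eRk (M.E \ X) := by gcongr
      _ = (M.eRk (M.E \ X) + k) + 2 := by ring
      _ ≤ _ := by gcongr; norm_num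
  have hn : ¬ ((4 : ℕ∞) ≤ 3) := by decide
  rcases hI4.2 _ _ hsep with h | h | h | h
  · rw [h.2] at h4; exact hn h4
  · rw [h.2] at h4; exact hn h4
  · rw [h.2] at h4'; exact hn h4'
  · rw [h.2] at h4'; exact hn h4'

lemma compl_card {α : Type*} {M : Matroid α} (hE : (14 : ℕ∞) ≤ M.E.encard) {X : Set α}
    (hX : X ⊆ M.E) (h7 : X.encard ≤ 7) : 4 ≤ (M.E \ X).encard := by
  by_contra hlt
  push Not at hlt
  have h1 := encard_sdiff_add_encard_of_subset hX
  have h2 : (M.E \ X).encard + X.encard ≤ 4 + 7 := by gcongr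
  rw [h1] at h2
  have := hE.trans h2
  revert this
  decide

lemma simple {α : Type*} {M : Matroid α} {v : α → (α →₀ ZMod 2)} (hv : Rep M v)
    (hI4 : InternallyFourConnected M) (hE : (14 : ℕ∞) ≤ M.E.encard) :
    ∀ x ∈ M.E, ∀ y ∈ M.E, v x = v y → x = y := by
  intro x hx y hy hxy
  by_contra hne
  have hX : {x, y} ⊆ M.E := by
    rintro z (rfl | rfl) <;> assumption
  have hc : ({x, y} : Set α).encard = 2 := encard_pair hne
  refine hI4.1 2 (by norm_num) (by norm_num) {x, y} (M.E \ {x, y})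
    ⟨disjoint_sdiff_right, union_sdiff_cancel hX, ?_, ?_, ?_⟩
  · unfold eRk
    simp only [eRank_eq]
    have h1 : M.eRk {x, y} ≤ 1 := by
      have : ({x, y} : Set α) ⊆ M.closure {y} := by
        rintro z (rfl | rfl)
        · rw [hv.mem_closure (by simpa using hy) hx, hxy]
          exact Submodule.subset_span (by simp)
        · exact M.mem_closure_of_mem (by simp) (by simpa using hy)
      calc _ ≤ _ := M.eRk_mono this
        _ = _ := M.eRk_closure_eq _
        _ ≤ _ := M.eRk_singleton_le y
    rw [add_comm]
    exact add_le_add (M.eRk_mono sdiff_subset) h1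
  · rw [hc]; rfl
  · refine le_trans ?_ (compl_card hE hX (by rw [hc]; decide))
    decide

lemma chr {α : Type*} (a : α →₀ ZMod 2) : a + a = 0 := by
  rw [← two_smul (ZMod 2) a]
  have : (2 : ZMod 2) = 0 := by decide
  simp [this]

lemma eq_of_sum {α : Type*} {a b x y : α →₀ ZMod 2} (h1 : a + b + x = 0) (h2 : a + b + y = 0) :
    x = y := add_left_cancel (h1.trans h2.symm)

lemma tri_vec3 {α : Type*} {M : Matroid α} {v : α → (α →₀ ZMod 2)} (hv : Rep M v)
    (hs : ∀ x ∈ M.E, ∀ y ∈ M.E, v x = v y → x = y) {x y z : α}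
    (hxy : x ≠ y) (hxz : x ≠ z) (hyz : y ≠ z)
    (h : IsTriangle M {x, y, z}) : v x + v y + v z = 0 := by
  obtain ⟨⟨hE, hni, hD⟩, -⟩ := h
  have hx : x ∈ M.E := hE (by simp)
  have hy : y ∈ M.E := hE (by simp)
  have hz : z ∈ M.E := hE (by simp)
  have hsub : ({x, y} : Set α) ⊆ M.E := by
    rintro w (rfl | rfl) <;> assumption
  have hi : M.Indep {x, y} := hD _ (by
    rw [Set.ssubset_iff_of_subset (by intro w; simp; tauto)]
    exact ⟨z, by simp, by simp [hxz.symm, hyz.symm]⟩)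
  have hiz : M.Indep {z} := hD _ (by
    rw [Set.ssubset_iff_of_subset (by intro w; simp; tauto)]
    exact ⟨x, by simp, by simpa using hxz⟩)
  have hz0 : v z ≠ 0 := by
    have := (hv {z} (by simpa using hz)).1 hiz
    exact this.ne_zero ⟨z, rfl⟩
  have hcl : z ∈ M.closure {x, y} := by
    rw [hi.mem_closure_iff_of_notMem (by simp [hxz.symm, hyz.symm]), Matroid.dep_iff]
    have : insert z {x, y} = ({x, y, z} : Set α) := by ext w; simp; tauto
    rw [this]
    exact ⟨hni, hE⟩
  rw [hv.mem_closure hsub hz, image_pair, Submodule.mem_span_pair] at hcl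
  obtain ⟨a, b, hab⟩ := hcl
  by_cases ha : a = 0
  · by_cases hb : b = 0
    · simp [ha, hb] at hab; exact absurd hab.symm hz0
    · simp [ha, z2 b hb] at hab; exact absurd (hs _ hy _ hz hab) hyz
  · by_cases hb : b = 0
    · simp [z2 a ha, hb] at hab; exact absurd (hs _ hx _ hz hab) hxz
    · rw [z2 a ha, z2 b hb, one_smul, one_smul] at hab
      rw [hab, chr]

lemma three_of_mem {α : Type*} {T : Set α} (hT : T.encard = 3) {a : α} (ha : a ∈ T) :
    ∃ x y, T = {a, x, y} ∧ a ≠ x ∧ a ≠ y ∧ x ≠ y := by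
  obtain ⟨p, q, r, hpq, hpr, hqr, rfl⟩ := encard_eq_three.1 hT
  rcases ha with rfl | rfl | rfl
  · exact ⟨q, r, rfl, hpq, hpr, hqr⟩
  · exact ⟨p, r, by ext; simp; tauto, hpq.symm, hqr, hpr⟩
  · exact ⟨p, q, by ext; simp; tauto, hpr.symm, hqr.symm, hpq⟩

lemma tri_share {α : Type*} {M : Matroid α} {v : α → (α →₀ ZMod 2)} (hv : Rep M v)
    (hs : ∀ x ∈ M.E, ∀ y ∈ M.E, v x = v y → x = y) {T T' : Set α} {a p : α} (hap : p ≠ a)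
    (h : IsTriangle M T) (h' : IsTriangle M T') (ha : a ∈ T) (ha' : a ∈ T')
    (hp : p ∈ T) (hp' : p ∈ T') : T = T' := by
  have key : ∀ T, IsTriangle M T → a ∈ T → p ∈ T →
      ∃ x ∈ M.E, T = {a, p, x} ∧ v a + v p + v x = 0 := by
    intro T h ha hp
    obtain ⟨x, y, rfl, h1, h2, h3⟩ := three_of_mem h.2 ha
    have hx : x ∈ M.E := h.1.1 (by simp)
    have hy : y ∈ M.E := h.1.1 (by simp)
    have hvv := tri_vec3 hv hs h1 h2 h3 h
    rcases hp with rfl | rfl | rfl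
    · exact absurd rfl hap
    · exact ⟨y, hy, rfl, hvv⟩
    · exact ⟨x, hx, by ext; simp; tauto, by rw [← hvv]; abel⟩
  obtain ⟨x, hx, rfl, e1⟩ := key T h ha hp
  obtain ⟨y, hy, rfl, e2⟩ := key T' h' ha' hp'
  rw [hs x hx y hy (eq_of_sum e1 e2)]

lemma tri_exists {α : Type*} {M : Matroid α} {v : α → (α →₀ ZMod 2)} (hv : Rep M v)
    (hs : ∀ x ∈ M.E, ∀ y ∈ M.E, v x = v y → x = y) (h3 : EveryElementInThreeTriangles M)
    {a : α} (ha : a ∈ M.E) (p q : α) (hp : p ≠ a) (hq : q ≠ a) :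
    ∃ x ∈ M.E, ∃ y ∈ M.E, x ≠ y ∧ x ≠ a ∧ y ≠ a ∧ x ≠ p ∧ x ≠ q ∧ y ≠ p ∧ y ≠ q ∧
      v a + v x + v y = 0 := by
  obtain ⟨A, B, C, hAB, hAC, hBC, hset⟩ := encard_eq_three.1 (h3 a ha)
  have hA : A ∈ {T : Set α | IsTriangle M T ∧ a ∈ T} := by rw [hset]; simp
  have hB : B ∈ {T : Set α | IsTriangle M T ∧ a ∈ T} := by rw [hset]; simp
  have hC : C ∈ {T : Set α | IsTriangle M T ∧ a ∈ T} := by rw [hset]; simp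
  have sh : ∀ r, r ≠ a → ∀ T T', IsTriangle M T ∧ a ∈ T → IsTriangle M T' ∧ a ∈ T' →
      T ≠ T' → r ∈ T → r ∉ T' := fun r hr T T' h h' hne h1 h2 =>
    hne (tri_share hv hs hr h.1 h'.1 h.2 h'.2 h1 h2)
  have : ∃ T, (IsTriangle M T ∧ a ∈ T) ∧ p ∉ T ∧ q ∉ T := by
    by_contra hcon
    push Not at hcon
    have p1 := sh p hp A B hA hB hAB
    have p2 := sh p hp A C hA hC hAC
    have p3 := sh p hp B C hB hC hBC
    have q1 := sh q hq A B hA hB hAB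
    have q2 := sh q hq A C hA hC hAC
    have q3 := sh q hq B C hB hC hBC
    have c1 := hcon A hA
    have c2 := hcon B hB
    have c3 := hcon C hC
    tauto
  obtain ⟨T, ⟨hT, haT⟩, hpT, hqT⟩ := this
  obtain ⟨x, y, rfl, h1, h2, h3⟩ := three_of_mem hT.2 haT
  simp only [mem_insert_iff, mem_singleton_iff, not_or] at hpT hqT
  exact ⟨x, hT.1.1 (by simp), y, hT.1.1 (by simp), h3, h1.symm, h2.symm, Ne.symm hpT.2.1,
    Ne.symm hqT.2.1, Ne.symm hpT.2.2, Ne.symm hqT.2.2, tri_vec3 hv hs h1 h2 h3 hT⟩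

lemma span3 {α : Type*} {W : Submodule (ZMod 2) (α →₀ ZMod 2)} {a b c : α →₀ ZMod 2}
    (h : a + b + c = 0) (ha : a ∈ W) (hb : b ∈ W) : c ∈ W := by
  have : c = -(a + b) := by rw [eq_neg_iff_add_eq_zero, add_comm]; exact h
  rw [this]
  exact W.neg_mem (W.add_mem ha hb)

lemma sep7 {α : Type*} {M : Matroid α} {v : α → (α →₀ ZMod 2)} (hv : Rep M v)
    (hI4 : InternallyFourConnected M) (hE : (14 : ℕ∞) ≤ M.E.encard)
    {e f₁ f₂ f₃ p q r : α} (hX : ({e, f₁, f₂, f₃, p, q, r} : Set α) ⊆ M.E)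
    (hc : 4 ≤ ({e, f₁, f₂, f₃, p, q, r} : Set α).encard)
    (hp : v p ∈ Submodule.span (ZMod 2) (v '' {e, f₁, f₂, f₃}))
    (hq : v q ∈ Submodule.span (ZMod 2) (v '' {e, f₁, f₂, f₃}))
    (hr : v r ∈ Submodule.span (ZMod 2) (v '' {e, f₁, f₂, f₃}))
    (ψ₁ ψ₂ : (α →₀ ZMod 2) →ₗ[ZMod 2] ZMod 2)
    (h10 : ∀ x ∈ M.E, x ∉ ({e, f₁, f₂, f₃} : Set α) → ψ₁ (v x) = 0)
    (h11 : ψ₁ (v e) = 1)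
    (h20 : ∀ x ∈ M.E, x ∉ ({e, f₁, f₂, f₃, p, q, r} : Set α) → ψ₂ (v x) = 0)
    (y : α) (hy : y ∈ M.E) (hy1 : ψ₁ (v y) = 0) (hy2 : ψ₂ (v y) = 1) : False := by
  set X : Set α := {e, f₁, f₂, f₃, p, q, r} with hXdef
  have he : e ∈ M.E := hX (by simp [hXdef])
  have h4E : ({e, f₁, f₂, f₃} : Set α) ⊆ M.E :=
    subset_trans (by intro x; simp [hXdef]; tauto) hX
  have hc7 : X.encard ≤ 7 := by
    rw [hXdef]
    refine (encard_insert_le _ _).trans ?_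
    have h7 : (7 : ℕ∞) = 1 + 1 + 1 + 1 + 1 + 1 + 1 := by norm_num
    rw [h7]
    gcongr
    iterate 5
      refine (encard_insert_le _ _).trans ?_
      gcongr
    simp
  refine i4_false hI4 hX 2 hc (compl_card hE hX hc7) ?_ ?_
  · have hsub : X ⊆ M.closure {e, f₁, f₂, f₃} := by
      intro x hx
      rw [hv.mem_closure h4E (hX hx)]
      rcases hx with h | h | h | h | h | h | h
      · subst h; exact Submodule.subset_span (mem_image_of_mem v (by simp))
      · subst h; exact Submodule.subset_span (mem_image_of_mem v (by simp))
      · subst h; exact Submodule.subset_span (mem_image_of_mem v (by simp))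
      · subst h; exact Submodule.subset_span (mem_image_of_mem v (by simp))
      · subst h; exact hp
      · subst h; exact hq
      · rw [mem_singleton_iff] at h; subst h; exact hr
    calc _ ≤ _ := M.eRk_mono hsub
      _ = _ := M.eRk_closure_eq _
      _ ≤ _ := M.eRk_le_encard _
      _ ≤ 1 + 1 + 1 + 1 := by
        refine (encard_insert_le _ _).trans ?_
        gcongr
        iterate 2
          refine (encard_insert_le _ _).trans ?_
          gcongr
        simp
      _ = _ := by norm_num
  · have e1 : M.eRk (insert y (M.E \ X)) = M.eRk (M.E \ X) + 1 :=
      Matroid.eRk_insert_eq_add_one ⟨hy, hv.notMem_closure sdiff_subset hy ψ₂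
        (fun x hx => h20 x hx.1 hx.2) (by rw [hy2]; decide)⟩
    have hsub : insert y (M.E \ X) ⊆ M.E := insert_subset hy sdiff_subset
    have e2 : M.eRk (insert e (insert y (M.E \ X))) = M.eRk (insert y (M.E \ X)) + 1 := by
      refine Matroid.eRk_insert_eq_add_one ⟨he, hv.notMem_closure hsub he ψ₁ ?_
        (by rw [h11]; decide)⟩
      rintro x (rfl | hx)
      · exact hy1
      · refine h10 x hx.1 fun hh => hx.2 ?_
        revert hh
        simp [hXdef]; tauto
    have : M.eRk (M.E \ X) + 2 = M.eRk (insert e (insert y (M.E \ X))) := by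
      rw [e2, e1, add_assoc]; norm_num
    rw [this]
    exact M.eRk_mono (insert_subset he hsub)

lemma sep4 {α : Type*} {M : Matroid α} {v : α → (α →₀ ZMod 2)} (hv : Rep M v)
    (hI4 : InternallyFourConnected M) (hE : (14 : ℕ∞) ≤ M.E.encard)
    {t a b y : α} (hX : ({y, t, a, b} : Set α) ⊆ M.E)
    (hc : ({y, t, a, b} : Set α).encard = 4)
    (hs : v t + v a + v y = 0)
    (ψ : (α →₀ ZMod 2) →ₗ[ZMod 2] ZMod 2)
    (h0 : ∀ x ∈ M.E, x ∉ ({y, t, a, b} : Set α) → ψ (v x) = 0)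
    (h1 : ψ (v t) = 1) : False := by
  have ht : t ∈ M.E := hX (by simp)
  have h3E : ({t, a, b} : Set α) ⊆ M.E := subset_trans (by intro x; simp; tauto) hX
  refine i4_false hI4 hX 1 hc.ge (compl_card hE hX (by rw [hc]; decide)) ?_ ?_
  · have hsub : ({y, t, a, b} : Set α) ⊆ M.closure {t, a, b} := by
      refine insert_subset ?_ (M.subset_closure _ h3E)
      rw [hv.mem_closure h3E (hX (by simp))]
      refine span3 hs ?_ ?_ <;> exact Submodule.subset_span (mem_image_of_mem v (by simp))
    calc _ ≤ _ := M.eRk_mono hsub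
      _ = _ := M.eRk_closure_eq _
      _ ≤ _ := M.eRk_le_encard _
      _ ≤ 1 + 1 + 1 := by
        refine (encard_insert_le _ _).trans ?_
        gcongr
        refine (encard_insert_le _ _).trans ?_
        gcongr
        simp
      _ = _ := by norm_num
  · rw [← Matroid.eRk_insert_eq_add_one (e := t) ⟨ht, hv.notMem_closure sdiff_subset ht ψ
        (fun x hx => h0 x hx.1 hx.2) (by rw [h1]; decide)⟩]
    exact M.eRk_mono (insert_subset ht sdiff_subset)

lemma par {α : Type*} {a b c : α →₀ ZMod 2} (h : a + b + c = 0)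
    (ψ : (α →₀ ZMod 2) →ₗ[ZMod 2] ZMod 2) : ψ a + ψ b + ψ c = 0 := by
  rw [← map_add, ← map_add, h, map_zero]

lemma z2_101 : ∀ a : ZMod 2, 1 + 0 + a = 0 → a = 1 := by decide
lemma z2_110 : ∀ a : ZMod 2, 1 + 1 + a = 0 → a = 0 := by decide
lemma z2_0ab : ∀ a b : ZMod 2, 0 + a + b = 0 → a = b := by decide
lemma z2_100 : ¬ (1 + 0 + 0 : ZMod 2) = 0 := by decide
lemma z2_111 : ¬ (1 + 1 + 1 : ZMod 2) = 0 := by decide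
lemma z2_01 : ¬ (0 : ZMod 2) = 1 := by decide

structure Cfg {α : Type*} (M : Matroid α) (v : α → (α →₀ ZMod 2)) (e f₁ f₂ f₃ g₁ g₂ g₃ : α)
    (T : Set α) (ψ₁ ψ₂ : (α →₀ ZMod 2) →ₗ[ZMod 2] ZMod 2) : Prop where
  hv : Rep M v
  hI4 : InternallyFourConnected M
  hE : (14 : ℕ∞) ≤ M.E.encard
  h3 : EveryElementInThreeTriangles M
  hs : ∀ x ∈ M.E, ∀ y ∈ M.E, v x = v y → x = y
  eE : e ∈ M.E
  f1E : f₁ ∈ M.E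
  f2E : f₂ ∈ M.E
  f3E : f₃ ∈ M.E
  g1E : g₁ ∈ M.E
  g2E : g₂ ∈ M.E
  g3E : g₃ ∈ M.E
  ef1 : e ≠ f₁
  ef2 : e ≠ f₂
  ef3 : e ≠ f₃
  f12 : f₁ ≠ f₂
  f13 : f₁ ≠ f₃
  f23 : f₂ ≠ f₃
  t1 : v e + v f₁ + v g₁ = 0
  t2 : v e + v f₂ + v g₂ = 0
  t3 : v e + v f₃ + v g₃ = 0
  p0 : ∀ x ∈ M.E, x ≠ e → x ≠ f₁ → x ≠ f₂ → x ≠ f₃ → ψ₁ (v x) = 0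
  pe : ψ₁ (v e) = 1
  pf1 : ψ₁ (v f₁) = 1
  pf2 : ψ₁ (v f₂) = 1
  pf3 : ψ₁ (v f₃) = 1
  TE : ∀ x ∈ T, x ∈ M.E
  eT : e ∉ T
  f1T : f₁ ∉ T
  f2T : f₂ ∉ T
  f3T : f₃ ∉ T
  cT : T.encard = 3
  q0 : ∀ x ∈ M.E, x ∉ T → x ≠ f₁ → x ≠ f₂ → x ≠ f₃ → ψ₂ (v x) = 0
  qT : ∀ x ∈ T, ψ₂ (v x) = 1

namespace Cfg

variable {α : Type*} {M : Matroid α} {v : α → (α →₀ ZMod 2)} {e f₁ f₂ f₃ g₁ g₂ g₃ : α}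
    {T : Set α} {ψ₁ ψ₂ : (α →₀ ZMod 2) →ₗ[ZMod 2] ZMod 2}

lemma swap12 (h : Cfg M v e f₁ f₂ f₃ g₁ g₂ g₃ T ψ₁ ψ₂) :
    Cfg M v e f₂ f₁ f₃ g₂ g₁ g₃ T ψ₁ ψ₂ :=
  { h with
    f1E := h.f2E, f2E := h.f1E, g1E := h.g2E, g2E := h.g1E, ef1 := h.ef2, ef2 := h.ef1
    f12 := h.f12.symm, f13 := h.f23, f23 := h.f13, t1 := h.t2, t2 := h.t1
    p0 := fun x hx a b c d => h.p0 x hx a c b d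
    pf1 := h.pf2, pf2 := h.pf1, f1T := h.f2T, f2T := h.f1T
    q0 := fun x hx a b c d => h.q0 x hx a c b d }

lemma swap23 (h : Cfg M v e f₁ f₂ f₃ g₁ g₂ g₃ T ψ₁ ψ₂) :
    Cfg M v e f₁ f₃ f₂ g₁ g₃ g₂ T ψ₁ ψ₂ :=
  { h with
    f2E := h.f3E, f3E := h.f2E, g2E := h.g3E, g3E := h.g2E, ef2 := h.ef3, ef3 := h.ef2
    f23 := h.f23.symm, f12 := h.f13, f13 := h.f12, t2 := h.t3, t3 := h.t2
    p0 := fun x hx a b c d => h.p0 x hx a b d c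
    pf2 := h.pf3, pf3 := h.pf2, f2T := h.f3T, f3T := h.f2T
    q0 := fun x hx a b c d => h.q0 x hx a b d c }

lemma qe (h : Cfg M v e f₁ f₂ f₃ g₁ g₂ g₃ T ψ₁ ψ₂) : ψ₂ (v e) = 0 :=
  h.q0 e h.eE h.eT h.ef1 h.ef2 h.ef3

lemma pg1 (h : Cfg M v e f₁ f₂ f₃ g₁ g₂ g₃ T ψ₁ ψ₂) : ψ₁ (v g₁) = 0 := by
  have := par h.t1 ψ₁
  rw [h.pe, h.pf1] at this
  exact z2_110 _ this

lemma qfg1 (h : Cfg M v e f₁ f₂ f₃ g₁ g₂ g₃ T ψ₁ ψ₂) : ψ₂ (v f₁) = ψ₂ (v g₁) := by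
  have := par h.t1 ψ₂
  rw [h.qe] at this
  exact z2_0ab _ _ this

lemma g1ne (h : Cfg M v e f₁ f₂ f₃ g₁ g₂ g₃ T ψ₁ ψ₂) :
    g₁ ≠ e ∧ g₁ ≠ f₁ ∧ g₁ ≠ f₂ ∧ g₁ ≠ f₃ := by
  have := h.pg1
  refine ⟨?_, ?_, ?_, ?_⟩ <;> rintro rfl
  · rw [h.pe] at this; exact z2_01 this.symm
  · rw [h.pf1] at this; exact z2_01 this.symm
  · rw [h.pf2] at this; exact z2_01 this.symm
  · rw [h.pf3] at this; exact z2_01 this.symm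

lemma g12 (h : Cfg M v e f₁ f₂ f₃ g₁ g₂ g₃ T ψ₁ ψ₂) : g₁ ≠ g₂ := by
  intro hg
  have h1 := h.t1
  have h2 := h.t2
  rw [← hg] at h2
  refine h.f12 (h.hs _ h.f1E _ h.f2E (eq_of_sum (a := v e) (b := v g₁) ?_ ?_))
  · rw [← h1]; abel
  · rw [← h2]; abel

lemma qf1_of (h : Cfg M v e f₁ f₂ f₃ g₁ g₂ g₃ T ψ₁ ψ₂) (hg : g₁ ∉ T) : ψ₂ (v f₁) = 0 := by
  obtain ⟨-, h1, h2, h3⟩ := h.g1ne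
  rw [h.qfg1, h.q0 g₁ h.g1E hg h1 h2 h3]

lemma qf1_of' (h : Cfg M v e f₁ f₂ f₃ g₁ g₂ g₃ T ψ₁ ψ₂) (hg : g₁ ∈ T) : ψ₂ (v f₁) = 1 := by
  rw [h.qfg1, h.qT g₁ hg]

/-- Separation in final form. -/
lemma sep (h : Cfg M v e f₁ f₂ f₃ g₁ g₂ g₃ T ψ₁ ψ₂) (hg : g₁ ∈ T) {p q : α}
    (hpE : p ∈ M.E) (hqE : q ∈ M.E)
    (hp : v p ∈ Submodule.span (ZMod 2) (v '' {e, f₁, f₂, f₃}))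
    (hq : v q ∈ Submodule.span (ZMod 2) (v '' {e, f₁, f₂, f₃}))
    (hT : ∀ x ∈ T, x = g₁ ∨ x = p ∨ x = q) : False := by
  have m : ∀ x ∈ ({e, f₁, f₂, f₃} : Set α),
      v x ∈ Submodule.span (ZMod 2) (v '' {e, f₁, f₂, f₃}) :=
    fun x hx => Submodule.subset_span (mem_image_of_mem v hx)
  refine sep7 h.hv h.hI4 h.hE (e := e) (f₁ := f₁) (f₂ := f₂) (f₃ := f₃) (p := g₁) (q := p)
    (r := q) ?_ ?_ (span3 h.t1 (m _ (by simp)) (m _ (by simp))) hp hq ψ₁ ψ₂ ?_ h.pe ?_ g₁ h.g1E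
    h.pg1 (h.qT _ hg)
  · have := h.eE; have := h.f1E; have := h.f2E; have := h.f3E; have := h.g1E
    rintro x (rfl | rfl | rfl | rfl | rfl | rfl | rfl) <;> assumption
  · have : ({e, f₁, f₂, f₃} : Set α).encard = 4 := by
      rw [encard_insert_of_notMem (by simp [h.ef1, h.ef2, h.ef3]),
        encard_insert_of_notMem (by simp [h.f12, h.f13]), encard_pair h.f23]
      norm_num
    rw [← this]
    apply encard_le_encard
    intro x; simp; tauto
  · intro x hx hn
    simp only [mem_insert_iff, mem_singleton_iff, not_or] at hn
    exact h.p0 x hx hn.1 hn.2.1 hn.2.2.1 hn.2.2.2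
  · intro x hx hn
    simp only [mem_insert_iff, mem_singleton_iff, not_or] at hn
    refine h.q0 x hx (fun hxT => ?_) hn.2.1 hn.2.2.1 hn.2.2.2.1
    have := hT x hxT
    tauto

/-- If `{a, f₁, x}` is a triangle and `a ≠ g₁` is outside the cocircuit then `x` is `f₂` or `f₃`. -/
lemma third (h : Cfg M v e f₁ f₂ f₃ g₁ g₂ g₃ T ψ₁ ψ₂) {a x : α} (haE : a ∈ M.E) (hxE : x ∈ M.E)
    (ha : a ∈ T) (hag : a ≠ g₁) (hx : x ≠ f₁) (hs : v a + v f₁ + v x = 0) :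
    x = f₂ ∨ x = f₃ := by
  by_contra hcon
  push Not at hcon
  have ha0 : ψ₁ (v a) = 0 := h.p0 a haE (fun hh => h.eT (hh ▸ ha)) (fun hh => h.f1T (hh ▸ ha))
    (fun hh => h.f2T (hh ▸ ha)) (fun hh => h.f3T (hh ▸ ha))
  have hxe : x ≠ e := by
    rintro rfl
    refine hag (h.hs _ haE _ h.g1E (eq_of_sum (a := v x) (b := v f₁) ?_ h.t1))
    rw [← hs]; abel
  have := par hs ψ₁
  rw [ha0, h.pf1, h.p0 x hxE hxe hx hcon.1 hcon.2] at this
  revert this; decide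

lemma case0 (h : Cfg M v e f₁ f₂ f₃ g₁ g₂ g₃ T ψ₁ ψ₂) (h1 : g₁ ∉ T) (h2 : g₂ ∉ T)
    (h3 : g₃ ∉ T) : False := by
  have k1 := h.qf1_of h1
  have k2 := h.swap12.qf1_of h2
  have k3 := h.swap23.swap12.qf1_of h3
  have q0 : ∀ x ∈ M.E, x ∉ T → ψ₂ (v x) = 0 := by
    intro x hx hxT
    by_cases e1 : x = f₁
    · rw [e1, k1]
    by_cases e2 : x = f₂
    · rw [e2, k2]
    by_cases e3 : x = f₃
    · rw [e3, k3]
    exact h.q0 x hx hxT e1 e2 e3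
  obtain ⟨t, a, b, hta, htb, hab, hT⟩ := encard_eq_three.1 h.cT
  have htT : t ∈ T := by simp [hT]
  have haT : a ∈ T := by simp [hT]
  have hbT : b ∈ T := by simp [hT]
  have hTn : ∀ x, x ≠ t → x ≠ a → x ≠ b → x ∉ T := by
    intro x; rw [hT]; simp; tauto
  obtain ⟨x, hx, y, hy, hxy, hxt, hyt, hxb, -, hyb, -, hs⟩ :=
    tri_exists h.hv h.hs h.h3 (h.TE t htT) b b htb.symm htb.symm
  have key : ∀ y ∈ M.E, y ≠ t → y ≠ b → y ≠ a → v t + v a + v y = 0 → False := by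
    intro y hy hyt hyb hya hs
    refine sep4 h.hv h.hI4 h.hE (t := t) (a := a) (b := b) (y := y) ?_ ?_ hs ψ₂ ?_ (h.qT t htT)
    · rintro z (rfl | rfl | rfl | rfl)
      · exact hy
      all_goals (apply h.TE; assumption)
    · rw [encard_insert_of_notMem (by simp [hyt, hyb, hya]), ← hT, h.cT]; norm_num
    · intro z hz hn
      rw [← hT] at hn
      exact q0 z hz fun hh => hn (Or.inr hh)
  by_cases hxa : x = a
  · rw [hxa] at hs hxy
    exact key y hy hyt hyb hxy.symm hs
  by_cases hya : y = a
  · rw [hya] at hs hxy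
    exact key x hx hxt hxb hxy (by rw [← hs]; abel)
  have := par hs ψ₂
  rw [h.qT t htT, q0 x hx (hTn x hxt hxa hxb), q0 y hy (hTn y hyt hya hyb)] at this
  exact z2_100 this

lemma mspan {x : α} (hx : x ∈ ({e, f₁, f₂, f₃} : Set α)) :
    v x ∈ Submodule.span (ZMod 2) (v '' {e, f₁, f₂, f₃}) :=
  Submodule.subset_span (mem_image_of_mem v hx)

lemma case1_aux (h : Cfg M v e f₁ f₂ f₃ g₁ g₂ g₃ T ψ₁ ψ₂) (h2 : g₂ ∉ T)
    (h3 : g₃ ∉ T) {a b : α} (hT : T = {g₁, a, b}) (hga : g₁ ≠ a) (hab : a ≠ b) :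
    v a ∈ Submodule.span (ZMod 2) (v '' {e, f₁, f₂, f₃}) := by
  have k2 := h.swap12.qf1_of h2
  have k3 := h.swap23.swap12.qf1_of h3
  have haT : a ∈ T := by simp [hT]
  have haE := h.TE a haT
  have hTn : ∀ x, x ≠ g₁ → x ≠ a → x ≠ b → x ∉ T := by
    intro x; rw [hT]; simp; tauto
  have fin : ∀ x ∈ M.E, x ≠ f₁ → v a + v f₁ + v x = 0 →
      v a ∈ Submodule.span (ZMod 2) (v '' {e, f₁, f₂, f₃}) := by
    intro x hx hxf hs
    have := h.third haE hx haT hga.symm hxf hs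
    refine span3 (a := v f₁) (b := v x) (by rw [← hs]; abel) (mspan (by simp)) ?_
    rcases this with rfl | rfl <;> exact mspan (by simp)
  obtain ⟨x, hx, y, hy, hxy, hxa, hya, hxg, hxb, hyg, hyb, hs⟩ :=
    tri_exists h.hv h.hs h.h3 haE g₁ b hga hab.symm
  by_cases hxf : x = f₁
  · rw [hxf] at hs hxy
    exact fin y hy hxy.symm hs
  by_cases hyf : y = f₁
  · rw [hyf] at hs hxy
    exact fin x hx hxy (by rw [← hs]; abel)
  exfalso
  have z : ∀ x ∈ M.E, x ≠ f₁ → x ∉ T → ψ₂ (v x) = 0 := by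
    intro x hx e1 hxT
    by_cases e2 : x = f₂
    · rw [e2, k2]
    by_cases e3 : x = f₃
    · rw [e3, k3]
    exact h.q0 x hx hxT e1 e2 e3
  have := par hs ψ₂
  rw [h.qT a haT, z x hx hxf (hTn x hxg hxa hxb), z y hy hyf (hTn y hyg hya hyb)] at this
  exact z2_100 this

lemma case1 (h : Cfg M v e f₁ f₂ f₃ g₁ g₂ g₃ T ψ₁ ψ₂) (h1 : g₁ ∈ T) (h2 : g₂ ∉ T)
    (h3 : g₃ ∉ T) : False := by
  obtain ⟨a, b, hT, hga, hgb, hab⟩ := three_of_mem h.cT h1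
  have hT' : T = {g₁, b, a} := by rw [hT]; ext; simp; tauto
  exact h.sep h1 (h.TE a (by simp [hT])) (h.TE b (by simp [hT]))
    (h.case1_aux h2 h3 hT hga hab) (h.case1_aux h2 h3 hT' hgb hab.symm)
    (by intro x; rw [hT]; simp)

lemma case2_aux (h : Cfg M v e f₁ f₂ f₃ g₁ g₂ g₃ T ψ₁ ψ₂) (h1 : g₁ ∈ T) (h2 : g₂ ∈ T)
    {a : α} (haT : a ∈ T) (ha1 : a ≠ g₁) 
    {x : α} (hx : x ∈ M.E) (hxf : x ≠ f₁) (hs : v a + v f₁ + v x = 0) :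
    v a ∈ Submodule.span (ZMod 2) (v '' {e, f₁, f₂, f₃}) := by
  rcases h.third (h.TE a haT) hx haT ha1 hxf hs with rfl | rfl
  · exfalso
    have := par hs ψ₂
    rw [h.qT a haT, h.qf1_of' h1, h.swap12.qf1_of' h2] at this
    exact z2_111 this
  · exact span3 (a := v f₁) (b := v x) (by rw [← hs]; abel) (mspan (by simp)) (mspan (by simp))

lemma case2 (h : Cfg M v e f₁ f₂ f₃ g₁ g₂ g₃ T ψ₁ ψ₂) (h1 : g₁ ∈ T) (h2 : g₂ ∈ T)
    (h3 : g₃ ∉ T) : False := by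
  have k3 := h.swap23.swap12.qf1_of h3
  have : ∃ a, T = {g₁, g₂, a} ∧ a ≠ g₁ ∧ a ≠ g₂ := by
    obtain ⟨a, b, hT, hga, hgb, hab⟩ := three_of_mem h.cT h1
    have h2' := h2
    rw [hT] at h2'
    rcases h2' with e2 | e2 | e2
    · exact absurd e2.symm h.g12
    · subst e2; exact ⟨b, hT, hgb.symm, hab.symm⟩
    · rw [mem_singleton_iff] at e2
      subst e2; exact ⟨a, by rw [hT]; ext; simp; tauto, hga.symm, hab⟩
  obtain ⟨a, hT, ha1, ha2⟩ := this
  have haT : a ∈ T := by simp [hT]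
  have haE := h.TE a haT
  have hTn : ∀ x, x ≠ g₁ → x ≠ g₂ → x ≠ a → x ∉ T := by
    intro x; rw [hT]; simp; tauto
  have fin : v a ∉ Submodule.span (ZMod 2) (v '' {e, f₁, f₂, f₃}) := by
    intro ha
    exact h.sep h1 h.g2E haE (span3 h.t2 (mspan (by simp)) (mspan (by simp))) ha
      (by intro x; rw [hT]; simp)
  have c1 : ∀ x ∈ M.E, x ≠ f₁ → v a + v f₁ + v x ≠ 0 := fun x hx hxf hs =>
    fin (h.case2_aux h1 h2 haT ha1 hx hxf hs)
  have c2 : ∀ x ∈ M.E, x ≠ f₂ → v a + v f₂ + v x ≠ 0 := fun x hx hxf hs => by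
    have := h.swap12.case2_aux h2 h1 haT ha2 hx hxf hs
    rw [show ({e, f₂, f₁, f₃} : Set α) = {e, f₁, f₂, f₃} by ext; simp; tauto] at this
    exact fin this
  obtain ⟨x, hx, y, hy, hxy, hxa, hya, hx1, hx2, hy1, hy2, hs⟩ :=
    tri_exists h.hv h.hs h.h3 haE g₁ g₂ ha1.symm ha2.symm
  have hs' : v a + v y + v x = 0 := by rw [← hs]; abel
  have z : ∀ x ∈ M.E, x ≠ f₁ → x ≠ f₂ → x ∉ T → ψ₂ (v x) = 0 := by
    intro x hx e1 e2 hxT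
    by_cases e3 : x = f₃
    · rw [e3, k3]
    exact h.q0 x hx hxT e1 e2 e3
  have x1 : x ≠ f₁ := fun hh => by
    rw [hh] at hs hxy; exact c1 y hy hxy.symm hs
  have x2 : x ≠ f₂ := fun hh => by
    rw [hh] at hs hxy; exact c2 y hy hxy.symm hs
  have y1 : y ≠ f₁ := fun hh => by
    rw [hh] at hs' hxy; exact c1 x hx hxy hs'
  have y2 : y ≠ f₂ := fun hh => by
    rw [hh] at hs' hxy; exact c2 x hx hxy hs'
  have := par hs ψ₂
  rw [h.qT a haT, z x hx x1 x2 (hTn x hx1 hx2 hxa), z y hy y1 y2 (hTn y hy1 hy2 hya)] at this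
  exact z2_100 this

lemma case3 (h : Cfg M v e f₁ f₂ f₃ g₁ g₂ g₃ T ψ₁ ψ₂) (h1 : g₁ ∈ T) (h2 : g₂ ∈ T)
    (h3 : g₃ ∈ T) : False := by
  have g12 := h.g12
  have g13 := h.swap23.g12
  have g23 := h.swap12.swap23.g12
  refine h.sep h1 h.g2E h.g3E (span3 h.t2 (mspan (by simp)) (mspan (by simp)))
    (span3 h.t3 (mspan (by simp)) (mspan (by simp))) ?_
  obtain ⟨p, q, r, hpq, hpr, hqr, hT⟩ := encard_eq_three.1 h.cT
  rw [hT] at h1 h2 h3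
  intro x hx
  rw [hT] at hx
  simp only [mem_insert_iff, mem_singleton_iff] at h1 h2 h3 hx
  grind

lemma contra (h : Cfg M v e f₁ f₂ f₃ g₁ g₂ g₃ T ψ₁ ψ₂) : False := by
  by_cases h1 : g₁ ∈ T <;> by_cases h2 : g₂ ∈ T <;> by_cases h3 : g₃ ∈ T
  · exact h.case3 h1 h2 h3
  · exact h.case2 h1 h2 h3
  · exact h.swap23.case2 h1 h3 h2
  · exact h.case1 h1 h2 h3
  · exact h.swap12.swap23.case2 h2 h3 h1
  · exact h.swap12.case1 h2 h1 h3
  · exact h.swap23.swap12.case1 h3 h1 h2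
  · exact h.case0 h1 h2 h3

end Cfg

lemma tri_ne {α : Type*} {x y z : α} (h : ({x, y, z} : Set α).encard = 3) :
    x ≠ y ∧ x ≠ z ∧ y ≠ z := by
  have two : ∀ a b : α, ({a, b} : Set α).encard ≤ 2 := fun a b => by
    refine (encard_insert_le _ _).trans ?_
    rw [encard_singleton]; norm_num
  have bad : ∀ a b : α, ({a, b} : Set α).encard ≠ 3 := fun a b hh => by
    have := two a b
    rw [hh] at this
    revert this; decide
  refine ⟨?_, ?_, ?_⟩ <;> rintro rfl
  · exact bad x z (by simpa using h)
  · exact bad x y (by rw [← h]; congr 1; ext; simp; tauto)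
  · exact bad x y (by simpa using h)

lemma quad_ne {α : Type*} {x y z w : α} (h : ({x, y, z, w} : Set α).encard = 4) :
    x ≠ y ∧ x ≠ z ∧ x ≠ w ∧ y ≠ z ∧ y ≠ w ∧ z ≠ w := by
  have bad : ∀ a b c : α, ({a, b, c} : Set α).encard ≠ 4 := fun a b c hh => by
    have : ({a, b, c} : Set α).encard ≤ 1 + 1 + 1 := by
      refine (encard_insert_le _ _).trans ?_
      gcongr
      refine (encard_insert_le _ _).trans ?_
      gcongr
      simp
    rw [hh] at this
    revert this; decide
  refine ⟨?_, ?_, ?_, ?_, ?_, ?_⟩ <;> rintro rfl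
  · exact bad x z w (by rw [← h]; congr 1; ext; simp)
  · exact bad x y w (by rw [← h]; congr 1; ext; simp; tauto)
  · exact bad x y z (by rw [← h]; congr 1; ext; simp; tauto)
  · exact bad x y w (by rw [← h]; congr 1; ext; simp)
  · exact bad x y z (by rw [← h]; congr 1; ext; simp; tauto)
  · exact bad x y z (by rw [← h]; congr 1; ext; simp)

theorem stmt14 (M : Matroid α) (hI4 : InternallyFourConnected M) (hB : Binary M)
    (h3 : EveryElementInThreeTriangles M) (hE : (14 : ℕ∞) ≤ M.E.encard)
    (e f₁ f₂ f₃ g₁ g₂ g₃ : α)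
    (hcard : ({e, f₁, f₂, f₃} : Set α).encard = 4)
    (hcc : Cocircuit M {e, f₁, f₂, f₃})
    (ht1 : IsTriangle M {e, f₁, g₁}) (ht2 : IsTriangle M {e, f₂, g₂})
    (ht3 : IsTriangle M {e, f₃, g₃}) :
    ∀ T, ¬ IsTriad (delete (contract M {e}) {f₁, f₂, f₃}) T := by

  intro T hTri
  obtain ⟨v, hv⟩ := hB
  have hv : Rep M v := hv
  have hs := simple hv hI4 hE
  obtain ⟨ef1, ef2, ef3, f12, f13, f23⟩ := quad_ne hcard
  have eE : e ∈ M.E := ht1.1.1 (by simp)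
  obtain ⟨a1, a2, a3⟩ := tri_ne ht1.2
  obtain ⟨b1, b2, b3⟩ := tri_ne ht2.2
  obtain ⟨c1, c2, c3⟩ := tri_ne ht3.2
  obtain ⟨ψ₁, p0, p1⟩ := cocircuit_functional hv hcc
  obtain ⟨TE, eT, TF, ψ₂, q0, q1⟩ := minor_functional hv eE
    (by simp [ef1, ef2, ef3]) hTri.1
  have TF' := Set.disjoint_right.1 TF
  exact Cfg.contra (M := M) (v := v) (e := e) (f₁ := f₁) (f₂ := f₂) (f₃ := f₃) (g₁ := g₁)
    (g₂ := g₂) (g₃ := g₃) (T := T) (ψ₁ := ψ₁) (ψ₂ := ψ₂)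
    { hv := hv, hI4 := hI4, hE := hE, h3 := h3, hs := hs, eE := eE
      f1E := ht1.1.1 (by simp), f2E := ht2.1.1 (by simp), f3E := ht3.1.1 (by simp)
      g1E := ht1.1.1 (by simp), g2E := ht2.1.1 (by simp), g3E := ht3.1.1 (by simp)
      ef1 := ef1, ef2 := ef2, ef3 := ef3, f12 := f12, f13 := f13, f23 := f23
      t1 := tri_vec3 hv hs a1 a2 a3 ht1
      t2 := tri_vec3 hv hs b1 b2 b3 ht2
      t3 := tri_vec3 hv hs c1 c2 c3 ht3
      p0 := fun x hx d1 d2 d3 d4 => p0 x hx (by simp [d1, d2, d3, d4])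
      pe := p1 e (by simp), pf1 := p1 f₁ (by simp), pf2 := p1 f₂ (by simp)
      pf3 := p1 f₃ (by simp)
      TE := fun x hx => TE hx, eT := eT
      f1T := TF' (by simp), f2T := TF' (by simp), f3T := TF' (by simp)
      cT := hTri.2
      q0 := fun x hx hxT d1 d2 d3 => q0 x hx hxT (by simp [d1, d2, d3])
      qT := q1 }

end Paper
end

section
/- There exists an internally 4-connected binary matroid M in which every element is in exactly three triangles, together with an element z of M, such that si(M/z) is not internally 4-connected. -/
open Set Matroid

namespace Paper

variable {α : Type*}

def cols : List ℕ := [192, 8, 3, 511, 256, 438, 32, 73, 2, 40, 1, 384, 512, 320, 16, 219, 640,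
  5, 365, 576, 64, 24, 292, 146, 768, 4, 128, 6, 7, 48, 56]
def col (i : ℕ) : ℕ := cols.getD i 0
def rows : List ℕ := [268862604, 411074860, 440795176, 1076134538, 1621147688, 1615069800,
  1876105, 75597865, 21243960, 17371136]
def tb (w v : ℕ) : Bool := Nat.beq (Nat.land 1 (Nat.shiftRight w v)) 1
def elim (v w u : ℕ) : ℕ := match tb u v with
  | true => Nat.xor u w
  | false => u
def upd (v : ℕ) : List ℕ → Option (List ℕ)
  | [] => none
  | w :: K => match tb w v with
    | true => some (K.map (elim v w))
    | false => match upd v K with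
      | none => none
      | some K' => some (w :: K')
def leaf (X Y : List ℕ) (b : ℕ) : Bool :=
  match X, Y, b with
  | [], _, _ => true
  | _, [], _ => true
  | [_], _, 0 => true
  | [_], _, 1 => true
  | _, [_], 0 => true
  | _, [_], 1 => true
  | [_, _], _, 0 => true
  | _, [_, _], 0 => true
  | [x, y, z], _, 0 => col x ^^^ col y ^^^ col z == 0
  | _, [x, y, z], 0 => col x ^^^ col y ^^^ col z == 0
  | _, _, _ => false
def chk : ℕ → List ℕ → List ℕ → List ℕ → List ℕ → ℕ → Bool
  | 0, X, Y, _, _, b => leaf X Y b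
  | n + 1, X, Y, KX, KY, b =>
    (match upd n KX with
      | none => chk n (n :: X) Y KX KY b
      | some K => match b with
        | 0 => true
        | b + 1 => chk n (n :: X) Y K KY b) &&
    (match upd n KY with
      | none => chk n X (n :: Y) KX KY b
      | some K => match b with
        | 0 => true
        | b + 1 => chk n X (n :: Y) KX K b)
def K0 : List ℕ := (upd 30 rows).getD []
abbrev VV := ℕ →₀ ZMod 2

noncomputable def vec (a : ℕ) : VV :=
  Finsupp.onFinset (Finset.range 10) (fun j => if j < 10 ∧ a.testBit j then 1 else 0) (by
    intro j hj; simp only [ne_eq, ite_eq_right_iff, Classical.not_imp] at hj; simp [hj.1.1])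

lemma vec_apply (a j : ℕ) : vec a j = if j < 10 ∧ a.testBit j then 1 else 0 := rfl

lemma vec_xor (a b : ℕ) : vec (a ^^^ b) = vec a + vec b := by
  ext j
  simp only [vec_apply, Finsupp.add_apply, Nat.testBit_xor]
  by_cases hj : j < 10 <;> cases a.testBit j <;> cases b.testBit j <;> simp [hj] <;> decide

lemma vec_eq_zero {a : ℕ} (ha : a < 1024) (h : vec a = 0) : a = 0 := by
  apply Nat.eq_of_testBit_eq
  intro j
  simp only [Nat.zero_testBit]
  by_cases hj : j < 10
  · have := DFunLike.congr_fun h j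
    rw [vec_apply] at this
    by_contra hc
    simp [hj, hc] at this
  · apply Nat.testBit_lt_two_pow
    calc a < 2 ^ 10 := ha
      _ ≤ 2 ^ j := Nat.pow_le_pow_right (by norm_num) (by omega)

lemma vec_self (a : ℕ) : vec a + vec a = 0 := by
  rw [← vec_xor]; simp; ext j; simp [vec_apply]

lemma vec_inj {a b : ℕ} (ha : a < 1024) (hb : b < 1024) (h : vec a = vec b) : a = b := by
  have : vec (a ^^^ b) = 0 := by rw [vec_xor, h, vec_self]
  have := vec_eq_zero (Nat.xor_lt_two_pow (n := 10) ha hb) this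
  exact Nat.xor_eq_zero_iff.1 this

noncomputable def phi (i : ℕ) : VV := vec (col i)

lemma col_lt (i : ℕ) (hi : i < 31) : col i < 1024 := by
  revert i; decide +kernel

lemma col_ne_zero (i : ℕ) (hi : i < 31) : col i ≠ 0 := by
  revert i; decide +kernel

lemma col_inj (i : ℕ) (hi : i < 31) : ∀ j < 31, col i = col j → i = j := by
  revert i; decide +kernel

lemma phi_inj {i j : ℕ} (hi : i < 31) (hj : j < 31) (h : phi i = phi j) : i = j :=
  col_inj i hi j hj (vec_inj (col_lt i hi) (col_lt j hj) h)

lemma phi_ne_zero {i : ℕ} (hi : i < 31) : phi i ≠ 0 :=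
  fun h => col_ne_zero i hi (vec_eq_zero (col_lt i hi) h)

lemma li_encard_le {I : Set ℕ} (hI : LinearIndepOn (ZMod 2) phi I) (w : Set VV) (hw : w.Finite)
    (h : ∀ i ∈ I, phi i ∈ Submodule.span (ZMod 2) w) : I.encard ≤ w.ncard := by
  have := hw.fintype
  have h1 := linearIndependent_le_span' (fun x : I => phi x.1) hI w (by
    rintro _ ⟨x, rfl⟩; exact h x.1 x.2)
  have h2 : I.Finite := by
    rw [← Set.finite_coe_iff, ← Cardinal.mk_lt_aleph0_iff]
    exact h1.trans_lt (Cardinal.natCast_lt_aleph0)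
  have := h2.fintype
  rw [Cardinal.mk_fintype, Nat.cast_le] at h1
  rw [← h2.cast_ncard_eq, Nat.cast_le]
  simpa using h1

def Ind (I : Set ℕ) : Prop := I ⊆ Iio 31 ∧ LinearIndepOn (ZMod 2) phi I

def IM : IndepMatroid ℕ := IndepMatroid.ofFinite (E := Iio 31) (finite_Iio 31) Ind
  ⟨empty_subset _, linearIndepOn_empty _ _⟩
  (fun _ _ hJ h => ⟨h.trans hJ.1, hJ.2.mono h⟩)
  (by
    intro I J hI hJ hlt
    by_contra! hc
    have hfin : I.Finite := (finite_Iio 31).subset hI.1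
    have key : ∀ e ∈ J, phi e ∈ Submodule.span (ZMod 2) (phi '' I) := by
      intro e he
      by_cases heI : e ∈ I
      · exact Submodule.subset_span ⟨e, heI, rfl⟩
      · by_contra hs
        exact hc e he heI ⟨insert_subset (hJ.1 he) hI.1, hI.2.insert hs⟩
    have := li_encard_le hJ.2 _ (hfin.image phi) key
    rw [← ((finite_Iio 31).subset hJ.1).cast_ncard_eq, Nat.cast_le] at this
    have h2 := Set.ncard_image_le (f := phi) hfin
    omega)
  (fun _ h => h.1)

def MM : Matroid ℕ := IM.matroid

lemma MM_E : MM.E = Iio 31 := rfl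
lemma MM_indep (I : Set ℕ) : MM.Indep I ↔ I ⊆ Iio 31 ∧ LinearIndepOn (ZMod 2) phi I := Iff.rfl

lemma bin : Binary MM := ⟨phi, fun I hI => ⟨fun h => h.2, fun h => ⟨hI, h⟩⟩⟩

lemma zmod2 (s : ZMod 2) : s = 0 ∨ s = 1 := by revert s; decide

lemma pair_indep {a b : ℕ} (ha : a < 31) (hb : b < 31) : MM.Indep {a, b} := by
  rw [MM_indep]
  refine ⟨by rintro x (rfl | rfl) <;> assumption, ?_⟩
  by_cases hab : a = b
  · subst hab
    simpa using phi_ne_zero ha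
  refine LinearIndepOn.insert ?_ ?_
  · simpa using phi_ne_zero hb
  · simp only [image_singleton]
    rw [Submodule.mem_span_singleton]
    rintro ⟨s, hs⟩
    rcases zmod2 s with rfl | rfl
    · simp only [zero_smul] at hs; exact phi_ne_zero ha hs.symm
    · simp only [one_smul] at hs; exact hab (phi_inj ha hb hs.symm)

lemma not_indep_iff {a b c : ℕ} (ha : a < 31) (hb : b < 31) (hc : c < 31)
    (hab : a ≠ b) (hac : a ≠ c) (hbc : b ≠ c) :
    ¬ MM.Indep {a, b, c} ↔ col a ^^^ col b ^^^ col c = 0 := by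
  have hsub : ({a, b, c} : Set ℕ) ⊆ Iio 31 := by
    rintro x (rfl | rfl | rfl) <;> assumption
  constructor
  · intro h
    have hs : phi a ∈ Submodule.span (ZMod 2) (phi '' {b, c}) := by
      by_contra hs
      exact h ⟨hsub, (pair_indep hb hc).2.insert hs⟩
    rw [image_pair, Submodule.mem_span_pair] at hs
    obtain ⟨s, t, hst⟩ := hs
    have h0 : vec (col a ^^^ col b ^^^ col c) = 0 := by
      rw [vec_xor, vec_xor]
      change phi a + phi b + phi c = 0
      rcases zmod2 s with rfl | rfl <;> rcases zmod2 t with rfl | rfl <;>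
        simp only [zero_smul, one_smul, zero_add, add_zero] at hst
      · exact absurd hst.symm (phi_ne_zero ha)
      · exact absurd (phi_inj hc ha hst).symm hac
      · exact absurd (phi_inj hb ha hst).symm hab
      · rw [add_assoc, hst]; exact vec_self _
    exact vec_eq_zero (Nat.xor_lt_two_pow (n := 10)
      (Nat.xor_lt_two_pow (n := 10) (col_lt a ha) (col_lt b hb)) (col_lt c hc)) h0
  · intro h hi
    have h1 : phi a ∉ Submodule.span (ZMod 2) (phi '' {b, c}) := by
      have := hi.2
      rw [linearIndepOn_insert (by simp [hab, hac])] at this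
      exact this.2
    apply h1
    rw [image_pair, Submodule.mem_span_pair]
    refine ⟨1, 1, ?_⟩
    simp only [one_smul]
    have : phi a + phi b + phi c = 0 := by
      have h2 : vec (col a ^^^ col b ^^^ col c) = 0 := by
        rw [h]; ext j; simp [vec_apply]
      rwa [vec_xor, vec_xor] at h2
    rw [add_assoc] at this
    have h3 : phi a + phi a = 0 := vec_self _
    exact (add_left_cancel (this.trans h3.symm))

lemma tri_of {a b c : ℕ} (ha : a < 31) (hb : b < 31) (hc : c < 31)
    (hab : a ≠ b) (hac : a ≠ c) (hbc : b ≠ c) (h : col a ^^^ col b ^^^ col c = 0) :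
    IsTriangle MM {a, b, c} := by
  refine ⟨⟨by rintro x (rfl | rfl | rfl) <;> assumption,
    (not_indep_iff ha hb hc hab hac hbc).2 h, ?_⟩, ?_⟩
  · intro D hD
    obtain ⟨x, hx, hxD⟩ := exists_of_ssubset hD
    have hDs := hD.subset
    rcases hx with rfl | rfl | rfl
    · refine (pair_indep hb hc).subset fun y hy => ?_
      rcases hDs hy with rfl | rfl | rfl <;> simp_all
    · refine (pair_indep ha hc).subset fun y hy => ?_
      rcases hDs hy with rfl | rfl | rfl <;> simp_all
    · refine (pair_indep ha hb).subset fun y hy => ?_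
      rcases hDs hy with rfl | rfl | rfl <;> simp_all
  · rw [encard_insert_of_notMem (by simp [hab, hac]), encard_pair hbc]; rfl

def TT (e : ℕ) : Finset (Finset ℕ) :=
  ((Finset.range 31 ×ˢ Finset.range 31).filter (fun p =>
    col e ^^^ col p.1 ^^^ col p.2 = 0 ∧ e ≠ p.1 ∧ e ≠ p.2 ∧ p.1 ≠ p.2)).image
    (fun p => {e, p.1, p.2})

lemma TT_card : ∀ e < 31, (TT e).card = 3 := by decide +kernel

lemma three : EveryElementInThreeTriangles MM := by
  intro e he
  have he : e < 31 := he
  have : {T : Set ℕ | IsTriangle MM T ∧ e ∈ T} = (fun F : Finset ℕ => (F : Set ℕ)) '' (TT e) := by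
    ext T
    simp only [mem_ofPred_eq, mem_image, Finset.mem_coe, TT, Finset.mem_image, Finset.mem_filter,
      Finset.mem_product, Finset.mem_range]
    constructor
    · rintro ⟨⟨⟨hE, hd, -⟩, hcard⟩, heT⟩
      have hcard2 : (T \ {e}).encard = 2 := by
        have := encard_sdiff_singleton_add_one heT
        rw [hcard] at this
        have h3 : (3 : ℕ∞) = 2 + 1 := by rfl
        rw [h3] at this
        exact (ENat.add_left_injective_of_ne_top (by simp)) this
      obtain ⟨a, b, hab, hT⟩ := encard_eq_two.1 hcard2
      have hTe : T = {e, a, b} := by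
        rw [← hT, insert_sdiff_singleton, insert_eq_of_mem heT]
      have ha : a ∈ T \ {e} := by rw [hT]; simp
      have hb : b ∈ T \ {e} := by rw [hT]; simp
      have ha31 : a < 31 := hE ha.1
      have hb31 : b < 31 := hE hb.1
      have hea : e ≠ a := fun h => ha.2 h.symm
      have heb : e ≠ b := fun h => hb.2 h.symm
      refine ⟨{e, a, b}, ⟨(a, b), ⟨⟨ha31, hb31⟩, ?_, hea, heb, hab⟩, rfl⟩, by simp [hTe]⟩
      rw [hTe] at hd
      exact (not_indep_iff he ha31 hb31 hea heb hab).1 hd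
    · rintro ⟨_, ⟨⟨a, b⟩, ⟨⟨ha, hb⟩, hx, h1, h2, h3⟩, rfl⟩, rfl⟩
      simp only [Finset.coe_insert, Finset.coe_singleton]
      exact ⟨tri_of he ha hb h1 h2 h3 hx, by simp⟩
  rw [this, Function.Injective.encard_image Finset.coe_injective, encard_coe_eq_coe_finsetCard,
    TT_card e he]
  rfl

lemma tb_eq (w v : ℕ) : tb w v = w.testBit v := by
  have h : Nat.land 1 (Nat.shiftRight w v) = (w >>> v) % 2 := Nat.one_and_eq_mod_two _
  have h2 : w.testBit v = decide ((w >>> v) % 2 = 1) := by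
    simp [Nat.testBit_eq_decide_div_mod_eq, Nat.shiftRight_eq_div_pow]
  rw [tb, h, h2, Bool.eq_iff_iff, decide_eq_true_iff, Nat.beq_eq]

def Lin (w : ℕ) : Prop :=
  ∃ f : VV →ₗ[ZMod 2] ZMod 2, ∀ i < 31, f (phi i) = if w.testBit i then 1 else 0

lemma Lin.xor {u w : ℕ} (hu : Lin u) (hw : Lin w) : Lin (u ^^^ w) := by
  obtain ⟨f, hf⟩ := hu
  obtain ⟨g, hg⟩ := hw
  refine ⟨f + g, fun i hi => ?_⟩
  rw [LinearMap.add_apply, hf i hi, hg i hi, Nat.testBit_xor]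
  cases u.testBit i <;> cases w.testBit i <;> decide

lemma rows_bits : ∀ j < 10, ∀ i < 31, (rows.getD j 0).testBit i = (col i).testBit j := by
  decide +kernel

lemma rows_lin : ∀ w ∈ rows, Lin w := by
  intro w hw
  obtain ⟨j, hj, rfl⟩ := List.mem_iff_getElem.1 hw
  have hj' : j < 10 := hj
  refine ⟨Finsupp.lapply j, fun i hi => ?_⟩
  have := rows_bits j hj' i hi
  rw [List.getD_eq_getElem _ _ hj] at this
  rw [this]
  simp [phi, vec_apply, hj']

structure Inv (K X : List ℕ) (r : ℕ) : Prop where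
  lin : ∀ w ∈ K, Lin w
  kill : ∀ w ∈ K, ∀ x ∈ X, w.testBit x = false
  rk : ∃ I : Finset ℕ, (∀ i ∈ I, i ∈ X) ∧ LinearIndepOn (ZMod 2) phi (I : Set ℕ) ∧ I.card = r

lemma upd_none {v : ℕ} : ∀ {K : List ℕ}, upd v K = none → ∀ w ∈ K, w.testBit v = false
  | [], _ => by simp
  | w :: K, h => by
    rw [upd] at h
    split at h
    · simp at h
    · rename_i hw
      split at h
      · rename_i hK
        intro u hu
        rcases List.mem_cons.1 hu with rfl | hu
        · rwa [tb_eq] at hw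
        · exact upd_none hK u hu
      · simp at h

lemma upd_some {v : ℕ} : ∀ {K K' : List ℕ}, upd v K = some K' →
    ∃ w ∈ K, w.testBit v = true ∧ ∀ u' ∈ K', (u' ∈ K ∧ u'.testBit v = false) ∨
      ∃ u ∈ K, u.testBit v = true ∧ u' = u ^^^ w
  | [], _, h => by simp [upd] at h
  | w :: K, K', h => by
    rw [upd] at h
    split at h
    · rename_i hw
      rw [tb_eq] at hw
      refine ⟨w, by simp, hw, ?_⟩
      simp only [Option.some.injEq] at h
      subst h
      intro u' hu'
      obtain ⟨u, hu, rfl⟩ := List.mem_map.1 hu'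
      rw [elim]
      split
      · rename_i h1
        rw [tb_eq] at h1
        exact Or.inr ⟨u, by simp [hu], h1, rfl⟩
      · rename_i h1
        rw [tb_eq] at h1
        exact Or.inl ⟨by simp [hu], h1⟩
    · rename_i hw
      rw [tb_eq] at hw
      split at h
      · simp at h
      · rename_i K'' hK
        simp only [Option.some.injEq] at h
        subst h
        obtain ⟨x, hx, hxv, hall⟩ := upd_some hK
        refine ⟨x, by simp [hx], hxv, ?_⟩
        intro u' hu'
        rcases List.mem_cons.1 hu' with rfl | hu'
        · exact Or.inl ⟨by simp, hw⟩
        · rcases hall u' hu' with h1 | ⟨u, h1, h2⟩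
          · exact Or.inl ⟨by simp [h1.1], h1.2⟩
          · exact Or.inr ⟨u, by simp [h1], h2⟩

lemma Inv.none {K X : List ℕ} {r v : ℕ} (h : Inv K X r) (hu : upd v K = none) :
    Inv K (v :: X) r := by
  refine ⟨h.lin, fun w hw x hx => ?_, ?_⟩
  · rcases List.mem_cons.1 hx with rfl | hx
    · exact upd_none hu w hw
    · exact h.kill w hw x hx
  · obtain ⟨I, h1, h2, h3⟩ := h.rk
    exact ⟨I, fun i hi => by simp [h1 i hi], h2, h3⟩

lemma Inv.some {K K' X : List ℕ} {r v : ℕ} (h : Inv K X r) (hX : ∀ x ∈ X, x < 31) (hv : v < 31)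
    (hu : upd v K = some K') : Inv K' (v :: X) (r + 1) := by
  obtain ⟨w, hw, hwv, hall⟩ := upd_some hu
  refine ⟨fun u' hu' => ?_, fun u' hu' x hx => ?_, ?_⟩
  · rcases hall u' hu' with h1 | ⟨u, h1, h2, rfl⟩
    · exact h.lin _ h1.1
    · exact (h.lin u h1).xor (h.lin w hw)
  · rcases hall u' hu' with h1 | ⟨u, h1, h2, rfl⟩
    · rcases List.mem_cons.1 hx with rfl | hx
      · exact h1.2
      · exact h.kill _ h1.1 x hx
    · rw [Nat.testBit_xor]
      rcases List.mem_cons.1 hx with rfl | hx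
      · rw [h2, hwv]; rfl
      · rw [h.kill _ h1 x hx, h.kill _ hw x hx]; rfl
  · obtain ⟨I, h1, h2, h3⟩ := h.rk
    obtain ⟨f, hf⟩ := h.lin w hw
    have hns : phi v ∉ Submodule.span (ZMod 2) (phi '' (I : Set ℕ)) := by
      intro hs
      have hle : Submodule.span (ZMod 2) (phi '' (I : Set ℕ)) ≤ LinearMap.ker f := by
        rw [Submodule.span_le]
        rintro _ ⟨i, hi, rfl⟩
        have hiX := h1 i hi
        simp [hf i (hX i hiX), h.kill w hw i hiX]
      have := hle hs
      rw [LinearMap.mem_ker, hf v hv, hwv] at this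
      simp at this
    have hvI : v ∉ I := fun hvI => hns (Submodule.subset_span ⟨v, hvI, rfl⟩)
    refine ⟨insert v I, ?_, ?_, ?_⟩
    · intro i hi
      rcases Finset.mem_insert.1 hi with rfl | hi
      · simp
      · simp [h1 i hi]
    · rw [Finset.coe_insert]
      exact h2.insert hns
    · rw [Finset.card_insert_of_notMem hvI, h3]

def Fin1 (A B : Set ℕ) : Prop :=
  (∃ I J : Finset ℕ, (I : Set ℕ) ⊆ A ∧ (J : Set ℕ) ⊆ B ∧ LinearIndepOn (ZMod 2) phi (I : Set ℕ) ∧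
    LinearIndepOn (ZMod 2) phi (J : Set ℕ) ∧ 13 ≤ I.card + J.card) ∨
  ∃ (X Y : List ℕ) (b : ℕ) (I J : Finset ℕ), A = {x | x ∈ X} ∧ B = {x | x ∈ Y} ∧ X.Nodup ∧ Y.Nodup ∧
    leaf X Y b = true ∧ (I : Set ℕ) ⊆ A ∧ (J : Set ℕ) ⊆ B ∧
    LinearIndepOn (ZMod 2) phi (I : Set ℕ) ∧
    LinearIndepOn (ZMod 2) phi (J : Set ℕ) ∧ I.card + J.card + b = 12

structure Side (A : Set ℕ) (n : ℕ) (X : List ℕ) : Prop where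
  nd : X.Nodup
  ge : ∀ x ∈ X, n ≤ x
  mem : ∀ i, n ≤ i → (i ∈ A ↔ i ∈ X)

lemma Side.cons {A : Set ℕ} {n : ℕ} {X : List ℕ} (h : Side A (n + 1) X) (hn : n ∈ A) :
    Side A n (n :: X) := by
  refine ⟨List.nodup_cons.2 ⟨fun hx => ?_, h.nd⟩, fun x hx => ?_, fun i hi => ?_⟩
  · have := h.ge n hx; omega
  · rcases List.mem_cons.1 hx with rfl | hx
    · exact le_rfl
    · have := h.ge x hx; omega
  · rcases Nat.lt_or_ge n i with h1 | h1
    · rw [h.mem i h1]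
      have : i ≠ n := by omega
      simp [this]
    · have : i = n := by omega
      subst this
      simp [hn]

lemma Side.skip {A : Set ℕ} {n : ℕ} {X : List ℕ} (h : Side A (n + 1) X) (hn : n ∉ A) :
    Side A n X := by
  refine ⟨h.nd, fun x hx => ?_, fun i hi => ?_⟩
  · have := h.ge x hx; omega
  · rcases Nat.lt_or_ge n i with h1 | h1
    · exact h.mem i h1
    · have : i = n := by omega
      subst this
      simp only [hn, false_iff]
      intro hx
      have := h.ge i hx; omega

lemma Side.sub {A : Set ℕ} {n : ℕ} {X : List ℕ} (h : Side A n X) {x : ℕ} (hx : x ∈ X) : x ∈ A :=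
  (h.mem x (h.ge x hx)).2 hx

lemma chk_sound {A B : Set ℕ} (hd : Disjoint A B) (hE : A ∪ B = Iio 31) :
    ∀ (n : ℕ) (X Y KX KY : List ℕ) (b r s : ℕ), n ≤ 31 → Side A n X → Side B n Y →
      Inv KX X r → Inv KY Y s → r + s + b = 12 → chk n X Y KX KY b = true → Fin1 A B := by
  have hA : ∀ x ∈ A, x < 31 := fun x hx => by
    have : x ∈ A ∪ B := Or.inl hx
    rw [hE] at this; exact this
  have hB : ∀ x ∈ B, x < 31 := fun x hx => by
    have : x ∈ A ∪ B := Or.inr hx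
    rw [hE] at this; exact this
  intro n
  induction n with
  | zero =>
    intro X Y KX KY b r s _ hX hY hKX hKY hb h
    rw [chk] at h
    obtain ⟨I, h1, h2, h3⟩ := hKX.rk
    obtain ⟨J, g1, g2, g3⟩ := hKY.rk
    refine Or.inr ⟨X, Y, b, I, J, ?_, ?_, hX.nd, hY.nd, h, fun i hi => hX.sub (h1 i hi),
      fun i hi => hY.sub (g1 i hi), h2, g2, by omega⟩
    · ext i; simpa using hX.mem i (Nat.zero_le _)
    · ext i; simpa using hY.mem i (Nat.zero_le _)
  | succ n ih =>
    intro X Y KX KY b r s hn hX hY hKX hKY hb h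
    rw [chk, Bool.and_eq_true] at h
    obtain ⟨hl, hr⟩ := h
    have hnE : n ∈ A ∪ B := by rw [hE]; exact hn
    have hX31 : ∀ x ∈ X, x < 31 := fun x hx => hA x (hX.sub hx)
    have hY31 : ∀ x ∈ Y, x < 31 := fun x hx => hB x (hY.sub hx)
    rcases hnE with hnA | hnB
    · have hnB : n ∉ B := fun h => Set.disjoint_left.1 hd hnA h
      have hX' := hX.cons hnA
      have hY' := hY.skip hnB
      split at hl
      · rename_i hu
        exact ih _ _ _ _ _ r s (by omega) hX' hY' (hKX.none hu) hKY hb hl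
      · rename_i K hu
        have hI := hKX.some hX31 hn hu
        split at hl
        · obtain ⟨I, h1, h2, h3⟩ := hI.rk
          obtain ⟨J, g1, g2, g3⟩ := hKY.rk
          exact Or.inl ⟨I, J, fun i hi => hX'.sub (h1 i hi),
            fun i hi => hY.sub (g1 i hi), h2, g2, by omega⟩
        · exact ih _ _ _ _ _ (r + 1) s (by omega) hX' hY' hI hKY (by omega) hl
    · have hnA : n ∉ A := fun h => Set.disjoint_left.1 hd h hnB
      have hX' := hX.skip hnA
      have hY' := hY.cons hnB
      split at hr
      · rename_i hu
        exact ih _ _ _ _ _ r s (by omega) hX' hY' hKX (hKY.none hu) hb hr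
      · rename_i K hu
        have hI := hKY.some hY31 hn hu
        split at hr
        · obtain ⟨I, h1, h2, h3⟩ := hKX.rk
          obtain ⟨J, g1, g2, g3⟩ := hI.rk
          exact Or.inl ⟨I, J, fun i hi => hX.sub (h1 i hi),
            fun i hi => hY'.sub (g1 i hi), h2, g2, by omega⟩
        · exact ih _ _ _ _ _ r (s + 1) (by omega) hX' hY' hKX hI (by omega) hr

lemma leaf_spec {X Y : List ℕ} {b : ℕ} (h : leaf X Y b = true) :
    X.length = 0 ∨ Y.length = 0 ∨ (b ≤ 1 ∧ (X.length = 1 ∨ Y.length = 1)) ∨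
    (b = 0 ∧ (X.length = 2 ∨ Y.length = 2 ∨
      (∃ x y z, X = [x, y, z] ∧ col x ^^^ col y ^^^ col z = 0) ∨
      (∃ x y z, Y = [x, y, z] ∧ col x ^^^ col y ^^^ col z = 0))) := by
  unfold leaf at h
  split at h <;> simp_all

lemma chk_ok : chk 30 [30] [] K0 rows 11 = true := by decide +kernel

lemma fin1 {A B : Set ℕ} (hd : Disjoint A B) (hE : A ∪ B = Iio 31) (h30 : 30 ∈ A) : Fin1 A B := by
  have hA : ∀ x ∈ A, x < 31 := fun x hx => by
    have : x ∈ A ∪ B := Or.inl hx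
    rw [hE] at this; exact this
  have hB : ∀ x ∈ B, x < 31 := fun x hx => by
    have : x ∈ A ∪ B := Or.inr hx
    rw [hE] at this; exact this
  have hnB : 30 ∉ B := fun h => Set.disjoint_left.1 hd h30 h
  have s1 : Side A 31 [] := ⟨by simp, by simp, fun i hi => by
    simp only [List.not_mem_nil, iff_false]; intro h; have := hA i h; omega⟩
  have s2 : Side B 31 [] := ⟨by simp, by simp, fun i hi => by
    simp only [List.not_mem_nil, iff_false]; intro h; have := hB i h; omega⟩
  have i0 : Inv rows [] 0 := ⟨rows_lin, by simp, ∅, by simp, by simp, by simp⟩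
  have hu : upd 30 rows = some K0 := by decide +kernel
  exact chk_sound hd hE 30 [30] [] K0 rows 11 1 0 (by norm_num) (s1.cons h30) (s2.skip hnB)
    (i0.some (by simp) (by norm_num) hu) i0 (by norm_num) chk_ok

lemma le_eRank {M : Matroid ℕ} {I X : Set ℕ} (hI : M.Indep I) (hX : I ⊆ X) :
    I.encard ≤ eRank M X := le_iSup₂_of_le (f := fun (I : Set ℕ)
      (_ : I ∈ {I : Set ℕ | M.Indep I ∧ I ⊆ X}) => I.encard) I ⟨hI, hX⟩ le_rfl

lemma eRank_le {M : Matroid ℕ} {X : Set ℕ} {n : ℕ∞}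
    (h : ∀ I, M.Indep I → I ⊆ X → I.encard ≤ n) : eRank M X ≤ n :=
  iSup₂_le fun I hI => h I hI.1 hI.2

lemma sup_bound {I : Set ℕ} (hI : LinearIndepOn (ZMod 2) phi I) (B : Finset ℕ)
    (h : ∀ i ∈ I, ∀ j < 10, (col i).testBit j = true → j ∈ B) : I.encard ≤ B.card := by
  have := li_encard_le hI ((fun j => Finsupp.single j (1 : ZMod 2)) '' (B : Set ℕ))
    (B.finite_toSet.image _) (by
      intro i hi
      have h1 : phi i ∈ Finsupp.supported (ZMod 2) (ZMod 2) (B : Set ℕ) := by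
        rw [Finsupp.mem_supported]
        intro j hj
        have hj : phi i j ≠ 0 := by simpa using hj
        rw [phi, vec_apply] at hj
        by_contra hc
        apply hj
        rw [if_neg]
        rintro ⟨h1, h2⟩
        exact hc (h i hi j h1 h2)
      rwa [Finsupp.supported_eq_span_single] at h1)
  refine this.trans ?_
  rw [Nat.cast_le]
  refine (Set.ncard_image_le B.finite_toSet).trans ?_
  simp

lemma eRk_MM : eRk MM ≤ 10 := by
  apply eRank_le
  intro I hI _
  simpa using sup_bound hI.2 (Finset.range 10) (fun i _ j hj _ => by simpa using hj)

lemma encard_list {X : List ℕ} (h : X.Nodup) : ({x | x ∈ X} : Set ℕ).encard = X.length := by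
  have : ({x | x ∈ X} : Set ℕ) = (X.toFinset : Set ℕ) := by ext; simp
  rw [this, encard_coe_eq_coe_finsetCard, List.toFinset_card_of_nodup h]

lemma tri_list {A : Set ℕ} {X : List ℕ} {x y z : ℕ} (hA : A ⊆ Iio 31) (h1 : A = {x | x ∈ X})
    (hn : X.Nodup) (h2 : X = [x, y, z]) (h3 : col x ^^^ col y ^^^ col z = 0) :
    IsTriangle MM A := by
  subst h2
  have h4 : A = {x, y, z} := by rw [h1]; ext; simp
  rw [h4] at hA ⊢
  simp at hn
  exact tri_of (hA (by simp)) (hA (by simp)) (hA (by simp)) hn.1.1 hn.1.2 hn.2 h3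

lemma sep_main {A B : Set ℕ} {k : ℕ} (hk : 1 ≤ k) (hk3 : k ≤ 3) (h : IsKSeparation MM k A B)
    (hf : Fin1 A B) : k = 3 ∧ (IsTriangle MM A ∨ IsTriangle MM B) := by
  obtain ⟨hd, hE, hr, hkA, hkB⟩ := h
  rw [MM_E] at hE
  have hA : A ⊆ Iio 31 := hE ▸ subset_union_left
  have hB : B ⊆ Iio 31 := hE ▸ subset_union_right
  have key : ∀ I J : Finset ℕ, (I : Set ℕ) ⊆ A → (J : Set ℕ) ⊆ B →
      LinearIndepOn (ZMod 2) phi (I : Set ℕ) → LinearIndepOn (ZMod 2) phi (J : Set ℕ) →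
      I.card + J.card ≤ 10 + (k - 1) := by
    intro I J hI hJ h1 h2
    have e1 := le_eRank (M := MM) ⟨hI.trans hA, h1⟩ hI
    have e2 := le_eRank (M := MM) ⟨hJ.trans hB, h2⟩ hJ
    have e3 := (add_le_add e1 e2).trans (hr.trans (add_le_add_left eRk_MM _))
    rw [encard_coe_eq_coe_finsetCard, encard_coe_eq_coe_finsetCard] at e3
    exact_mod_cast e3
  rcases hf with ⟨I, J, hI, hJ, h1, h2, h3⟩ | ⟨X, Y, b, I, J, hX, hY, hnX, hnY, hl, hI, hJ, h1, h2, h3⟩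
  · have := key I J hI hJ h1 h2
    omega
  · have := key I J hI hJ h1 h2
    rw [hX, encard_list hnX, Nat.cast_le] at hkA
    rw [hY, encard_list hnY, Nat.cast_le] at hkB
    rcases leaf_spec hl with h | h | ⟨hb, h | h⟩ | ⟨hb, h | h | ⟨x, y, z, hh, h⟩ | ⟨x, y, z, hh, h⟩⟩
    · omega
    · omega
    · omega
    · omega
    · omega
    · omega
    · exact ⟨by omega, Or.inl (tri_list hA hX hnX hh h)⟩
    · exact ⟨by omega, Or.inr (tri_list hB hY hnY hh h)⟩

lemma sep_symm {M : Matroid ℕ} {A B : Set ℕ} {k : ℕ} (h : IsKSeparation M k A B) :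
    IsKSeparation M k B A := by
  obtain ⟨hd, hE, hr, hkA, hkB⟩ := h
  exact ⟨hd.symm, by rw [union_comm, hE], by rwa [add_comm], hkB, hkA⟩

lemma sep_all {A B : Set ℕ} {k : ℕ} (hk : 1 ≤ k) (hk3 : k ≤ 3) (h : IsKSeparation MM k A B) :
    k = 3 ∧ (IsTriangle MM A ∨ IsTriangle MM B) := by
  have h30 : (30 : ℕ) ∈ A ∪ B := by rw [h.2.1, MM_E]; simp
  rcases h30 with h30 | h30
  · exact sep_main hk hk3 h (fin1 h.1 h.2.1 h30)
  · have := sep_main hk hk3 (sep_symm h) (fin1 h.1.symm (sep_symm h).2.1 h30)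
    exact ⟨this.1, this.2.symm⟩

lemma i4c : InternallyFourConnected MM := by
  refine ⟨fun k h1 h2 X Y h => ?_, fun X Y h => ?_⟩
  · have := (sep_all h1 (by omega) h).1
    omega
  · rcases (sep_all (by norm_num) le_rfl h).2 with h | h
    · exact Or.inl h
    · exact Or.inr (Or.inr (Or.inl h))

def SF : Finset ℕ := (Finset.range 31).filter (fun i => i ≠ 20 ∧ i ≠ 0 ∧ i ≠ 13 ∧ i ≠ 19)
def XF : Finset ℕ := {26, 4, 11, 12, 16, 24}
def YF : Finset ℕ := SF \ XF

abbrev MC : Matroid ℕ := contract MM {20}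

lemma MC_eq : MC = MM ／ {20} := rfl

lemma MC_E : MC.E = Iio 31 \ {20} := rfl

lemma MC_indep (I : Set ℕ) : MC.Indep I ↔ 20 ∉ I ∧ MM.Indep (insert 20 I) := by
  rw [MC_eq]
  apply IsNonloop.contractElem_indep_iff
  rw [← indep_singleton]
  simpa using pair_indep (a := 20) (b := 20) (by norm_num) (by norm_num)

lemma MC_nonloop {e : ℕ} (he : e < 31) (h : e ≠ 20) : MC.IsNonloop e := by
  rw [← indep_singleton, MC_indep]
  exact ⟨by simpa using h.symm, pair_indep (by norm_num) he⟩

lemma MC_cl {e f : ℕ} (he : e < 31) (h : e ≠ 20) (hf : f < 31) (h' : f ≠ 20) :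
    MC.closure {e} = MC.closure {f} ↔ e = f ∨ col 20 ^^^ col e ^^^ col f = 0 := by
  rw [(MC_nonloop he h).closure_eq_closure_iff_eq_or_dep (MC_nonloop hf h'), MC_indep]
  by_cases hef : e = f
  · simp [hef]
  · simp only [hef, false_or]
    rw [← not_indep_iff (by norm_num) he hf h.symm h'.symm hef]
    simp [h.symm, h'.symm]

lemma SF_uniq : ∀ e ∈ SF, ∀ f ∈ SF, col 20 ^^^ col e ^^^ col f = 0 → e = f := by decide +kernel
lemma SF_ex : ∀ f < 31, f ≠ 20 → ∃ e ∈ SF, e = f ∨ col 20 ^^^ col e ^^^ col f = 0 := by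
  decide +kernel
lemma SF_lt : ∀ e ∈ SF, e < 31 ∧ e ≠ 20 := by decide +kernel

lemma simpl : IsSimplificationOf (MC ↾ (SF : Set ℕ)) MC := by
  refine ⟨SF, ?_, rfl, ?_, ?_⟩
  · intro e he
    exact ⟨(SF_lt e he).1, (SF_lt e he).2⟩
  · intro e he
    exact (MC_nonloop (SF_lt e he).1 (SF_lt e he).2).indep
  · intro f hf
    have hfE : f ∈ MC.E := hf.subset_ground (mem_singleton f)
    obtain ⟨hf31, hf20⟩ := hfE
    have hf31 : f < 31 := hf31
    have hf20 : f ≠ 20 := hf20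
    obtain ⟨e, he, hef⟩ := SF_ex f hf31 hf20
    have hc := (MC_cl (SF_lt e he).1 (SF_lt e he).2 hf31 hf20).2 hef
    refine ⟨e, ⟨he, hc⟩, ?_⟩
    rintro e' ⟨he', hc'⟩
    rw [← hc] at hc'
    rcases (MC_cl (SF_lt e' he').1 (SF_lt e' he').2 (SF_lt e he).1 (SF_lt e he).2).1 hc' with h | h
    · exact h
    · exact SF_uniq e' he' e he h

lemma N_bound {X : Set ℕ} (B : Finset ℕ) (n : ℕ) (hn : B.card = n + 1)
    (h : ∀ i ∈ insert 20 X, ∀ j < 10, (col i).testBit j = true → j ∈ B) :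
    eRank (MC ↾ (SF : Set ℕ)) X ≤ n := by
  apply eRank_le
  intro I hI hIX
  have hI' := (MC_indep I).1 (restrict_indep_iff.1 hI).1
  have := sup_bound hI'.2.2 B (fun i hi => h i (insert_subset_insert hIX hi))
  rw [encard_insert_of_notMem hI'.1, hn, Nat.cast_add, Nat.cast_one] at this
  exact (ENat.add_le_add_iff_right (by simp)).1 this

def uu (j : ℕ) : ℕ := [10, 8, 25, 1, 14, 6, 20, 26, 4, 12].getD j 0
lemma uu_col : ∀ j < 10, col (uu j) = 2 ^ j := by decide +kernel

lemma uu_indep : MM.Indep (uu '' (Iio 10)) := by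
  refine ⟨?_, ?_⟩
  · rintro _ ⟨j, hj, rfl⟩
    have : ∀ j < 10, uu j < 31 := by decide +kernel
    exact this j hj
  · apply LinearIndepOn.image_of_comp
    have h1 : LinearIndepOn (ZMod 2) (fun j : ℕ => Finsupp.single j (1 : ZMod 2)) (Iio 10) :=
      (Finsupp.linearIndependent_single_one (ZMod 2) ℕ).linearIndepOn _
    refine h1.congr fun j hj => ?_
    have hj : j < 10 := hj
    ext i
    simp only [Function.comp, phi, uu_col j hj, vec_apply, Nat.testBit_two_pow,
      Finsupp.single_apply]
    by_cases hij : j = i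
    · subst hij; simp [hj]
    · simp [hij]

def I0 : Finset ℕ := {10, 8, 25, 1, 14, 6, 26, 4, 12}

lemma I0_indep : (MC ↾ (SF : Set ℕ)).Indep (I0 : Set ℕ) := by
  rw [restrict_indep_iff, MC_indep]
  refine ⟨⟨by decide, ?_⟩, ?_⟩
  · convert uu_indep using 1
    have h1 : ((insert 20 I0 : Finset ℕ) : Set ℕ) = (((Finset.range 10).image uu : Finset ℕ) : Set ℕ) := by
      congr 1
      decide +kernel
    simpa using h1
  · exact Finset.coe_subset.2 (by decide)

lemma not_si : ¬ SiContractI4C MM 20 := by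
  intro h
  have h1 := (h _ simpl).2 (XF : Set ℕ) (YF : Set ℕ) (by
    refine ⟨?_, ?_, ?_, ?_, ?_⟩
    · exact Finset.disjoint_coe.2 (by decide)
    · rw [← Finset.coe_union]
      change _ = (SF : Set ℕ)
      congr 1
      decide +kernel
    · have e1 : eRank (MC ↾ (SF : Set ℕ)) XF ≤ (3 : ℕ) := by
        apply N_bound {6, 7, 8, 9} 3 rfl
        rw [← Finset.coe_insert]
        have : ∀ i ∈ insert 20 XF, ∀ j < 10, (col i).testBit j = true →
          j ∈ ({6, 7, 8, 9} : Finset ℕ) := by decide +kernel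
        exact this
      have e2 : eRank (MC ↾ (SF : Set ℕ)) YF ≤ (8 : ℕ) := by
        apply N_bound (Finset.range 9) 8 rfl
        rw [← Finset.coe_insert]
        have : ∀ i ∈ insert 20 YF, ∀ j < 10, (col i).testBit j = true →
          j ∈ Finset.range 9 := by decide +kernel
        exact this
      have e3 : ((9 : ℕ) : ℕ∞) ≤ eRk (MC ↾ (SF : Set ℕ)) := by
        have := le_eRank I0_indep I0_indep.subset_ground
        rwa [encard_coe_eq_coe_finsetCard, show I0.card = 9 from rfl] at this
      calc _ ≤ ((3 : ℕ) : ℕ∞) + (8 : ℕ) := add_le_add e1 e2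
        _ = ((9 : ℕ) : ℕ∞) + ((3 - 1 : ℕ) : ℕ∞) := by norm_cast
        _ ≤ _ := add_le_add_left e3 _
    · rw [encard_coe_eq_coe_finsetCard, Nat.cast_le]; decide
    · rw [encard_coe_eq_coe_finsetCard, Nat.cast_le]; decide)
  have hX : (XF : Set ℕ).encard ≠ 3 := by
    rw [encard_coe_eq_coe_finsetCard, show XF.card = 6 from rfl]; decide
  have hY : (YF : Set ℕ).encard ≠ 3 := by
    rw [encard_coe_eq_coe_finsetCard, show YF.card = 21 from rfl]; decide
  rcases h1 with h | h | h | h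
  · exact hX h.2
  · exact hX h.2
  · exact hY h.2
  · exact hY h.2

theorem stmt15 :
    ∃ (M : Matroid ℕ) (z : ℕ), Binary M ∧ InternallyFourConnected M ∧
      EveryElementInThreeTriangles M ∧ z ∈ M.E ∧ ¬ SiContractI4C M z :=
  ⟨MM, 20, bin, i4c, three, by rw [MM_E]; simp, not_si⟩

end Paper
end
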